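/- Fix L ∈ (0, π), and for each n let s_n ∈ (0, 1) satisfy s_n ≤ (tan(L/4))^{2n}, and let φ_n be the orthogonal polynomial with parameter s = s_n. Let ν_n = (1/n) Σ_{z : φ_n(z)=0} δ_z be the normalized zero counting measure of φ_n (zeros counted with multiplicity). Then ν_n converges weakly, as n → ∞, to the probability measure μ_{∞,L} on the unit circle supported on the arc {e^{iθ} : θ ∈ [−L, L]} with density dμ_{∞,L}(e^{iθ}) = (1/(2π))·√((cos θ + 1)/(cos θ − cos L)) dθ there. -/

import Mathlib

open Real Filter MeasureTheory

/-- The weight on the unit circle: `f(e^{iθ}) = 1` for `θ ∈ (-L,L)` (mod 2π), i.e. when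
`cos θ > cos L`, and `f(e^{iθ}) = s` otherwise. -/
noncomputable def weight (L s θ : ℝ) : ℝ := if Real.cos L < Real.cos θ then 1 else s

theorem norm_one_sub_mul_eq_norm_sub_star {p η : ℂ} (hη : ‖η‖ = 1) :
    ‖1 - p * η‖ = ‖η - star p‖ := by
  have h : star η * η = 1 := by
    have := Complex.conj_mul' η
    rw [hη] at this
    simpa using this
  calc ‖1 - p * η‖ = ‖(star η - p) * η‖ := by rw [sub_mul, h]
    _ = ‖star (η - star p)‖ := by rw [norm_mul, hη, mul_one, star_sub, star_star]
    _ = ‖η - star p‖ := norm_star _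

theorem intervalIntegrable_log_norm_one_sub_mul (p : ℂ) :
    IntervalIntegrable (fun u : ℝ => log ‖1 - p * Complex.exp (u * Complex.I)‖) volume 0 (2 * π) := by
  have := circleIntegrable_log_norm_sub_const (a := star p) (c := 0) 1
  simp only [CircleIntegrable, circleMap_zero, Complex.ofReal_one, one_mul] at this
  convert this using 3 with u
  exact norm_one_sub_mul_eq_norm_sub_star (Complex.norm_exp_ofReal_mul_I u)

theorem integral_log_norm_one_sub_mul (p : ℂ) :
    ∫ u in (0:ℝ)..(2 * π), log ‖1 - p * Complex.exp (u * Complex.I)‖ = 2 * π * log⁺ ‖p‖ := by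
  have := circleAverage_log_norm_sub_const_eq_posLog (a := star p)
  simp only [circleAverage, circleMap_zero, Complex.ofReal_one, one_mul, norm_star] at this
  rw [← this, smul_eq_mul, mul_inv_cancel_left₀ (by positivity)]
  refine intervalIntegral.integral_congr fun u _ => ?_
  simp only [norm_one_sub_mul_eq_norm_sub_star (Complex.norm_exp_ofReal_mul_I u)]

theorem integral_exp_int_mul_I (m : ℤ) :
    ∫ u in (0:ℝ)..(2 * π), Complex.exp (m * u * Complex.I) = if m = 0 then 2 * (π : ℂ) else 0 := by
  split_ifs with h
  · simp [h]
  · have hc : (m : ℂ) * Complex.I ≠ 0 := by simp [h]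
    have := integral_exp_mul_complex (a := 0) (b := 2 * π) hc
    rw [show (fun u : ℝ => Complex.exp (m * u * Complex.I)) =
      fun u : ℝ => Complex.exp (m * Complex.I * u) from by ext u; ring_nf, this]
    have h2 : Complex.exp (m * Complex.I * (2 * π : ℝ)) = 1 := by
      rw [Complex.exp_eq_one_iff]; exact ⟨m, by push_cast; ring⟩
    rw [h2]; simp

theorem integral_log_norm_one_sub_mul_mul_exp_of_lt {q : ℂ} (hq : ‖q‖ < 1) {k : ℕ} (hk : k ≠ 0) :
    ∫ u in (0:ℝ)..(2 * π), (log ‖1 - q * Complex.exp (u * Complex.I)‖ : ℂ) *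
      Complex.exp (-(k : ℂ) * u * Complex.I) = -π * q ^ k / k := by
  set F : ℕ → ℝ → ℂ := fun m u => -(q ^ m / (2 * m)) * Complex.exp (((m - k : ℤ) : ℂ) * u * Complex.I)
    - (star q) ^ m / (2 * m) * Complex.exp (((-m - k : ℤ) : ℂ) * u * Complex.I) with hF
  have hsum : ∀ u : ℝ, HasSum (fun m => F m u) ((log ‖1 - q * Complex.exp (u * Complex.I)‖ : ℂ) *
      Complex.exp (-(k : ℂ) * u * Complex.I)) := by
    intro u
    have h1 := Complex.hasSum_taylorSeries_neg_log (z := q * Complex.exp (u * Complex.I))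
      (by rw [norm_mul, Complex.norm_exp_ofReal_mul_I, mul_one]; exact hq)
    have h2 := (Complex.hasSum_conj'.mpr h1)
    have h3 := ((h1.add h2).mul_left (-(1/2 : ℂ))).mul_right (Complex.exp (-(k : ℂ) * u * Complex.I))
    have hval : (log ‖1 - q * Complex.exp (u * Complex.I)‖ : ℂ) =
        -(1 / 2) * (-Complex.log (1 - q * Complex.exp (u * Complex.I)) +
          (starRingEnd ℂ) (-Complex.log (1 - q * Complex.exp (u * Complex.I)))) := by
      rw [← Complex.log_re, map_neg, Complex.re_eq_add_conj]
      ring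
    rw [hval]
    refine Eq.subst (motive := fun f => HasSum f _) (funext fun m => ?_) h3
    have e1 : Complex.exp (((m - k : ℤ) : ℂ) * u * Complex.I) =
        Complex.exp (u * Complex.I) ^ m * Complex.exp (-(k : ℂ) * u * Complex.I) := by
      rw [← Complex.exp_nat_mul, ← Complex.exp_add]; congr 1; push_cast; ring
    have e2 : Complex.exp (((-m - k : ℤ) : ℂ) * u * Complex.I) =
        (starRingEnd ℂ (Complex.exp (u * Complex.I))) ^ m *
          Complex.exp (-(k : ℂ) * u * Complex.I) := by
      rw [← Complex.exp_conj, ← Complex.exp_nat_mul, ← Complex.exp_add]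
      congr 1; push_cast; simp; ring
    simp only [hF, e1, e2, map_div₀, map_pow, map_mul, map_natCast, mul_pow,
      RCLike.star_def, ← div_div]
    ring
  have hint : HasSum (fun m => ∫ u in (0:ℝ)..(2 * π), F m u) (∫ u in (0:ℝ)..(2 * π),
      (log ‖1 - q * Complex.exp (u * Complex.I)‖ : ℂ) * Complex.exp (-(k : ℂ) * u * Complex.I)) := by
    refine intervalIntegral.hasSum_integral_of_dominated_convergence (fun m _ => ‖q‖ ^ m) ?_ ?_ ?_ ?_ ?_
    · intro m
      exact (by fun_prop : Continuous (F m)).aestronglyMeasurable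
    · intro m
      refine Eventually.of_forall fun u _ => ?_
      have hn : ∀ j : ℤ, ‖Complex.exp ((j : ℂ) * u * Complex.I)‖ = 1 := fun j => by
        rw [show (j : ℂ) * u * Complex.I = ((j * u : ℝ) : ℂ) * Complex.I by push_cast; ring]
        exact Complex.norm_exp_ofReal_mul_I _
      have hm : ‖q‖ ^ m / (2 * m) ≤ ‖q‖ ^ m / 2 := by
        rcases Nat.eq_zero_or_pos m with rfl | h
        · simp
        · have : (1:ℝ) ≤ m := by exact_mod_cast h
          gcongr
          linarith
      refine (norm_sub_le _ _).trans ?_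
      rw [norm_mul, norm_mul, hn, hn]
      simp only [norm_neg, norm_div, norm_pow, norm_mul, norm_star, Complex.norm_natCast,
        Complex.norm_ofNat, mul_one]
      linarith
    · exact Eventually.of_forall fun u _ => summable_geometric_of_lt_one (norm_nonneg _) hq
    · simp
    · exact Eventually.of_forall fun u _ => hsum u
  have hval : ∀ m, ∫ u in (0:ℝ)..(2 * π), F m u = if m = k then -π * q ^ k / k else 0 := by
    intro m
    simp only [hF]
    rw [intervalIntegral.integral_sub
      ((by fun_prop : Continuous _).intervalIntegrable _ _)
      ((by fun_prop : Continuous _).intervalIntegrable _ _),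
      intervalIntegral.integral_const_mul, intervalIntegral.integral_const_mul,
      integral_exp_int_mul_I, integral_exp_int_mul_I, if_neg (by omega : ¬ (-(m:ℤ) - k = 0))]
    by_cases h : m = k
    · subst h
      have : (m : ℂ) ≠ 0 := by exact_mod_cast hk
      simp
      field_simp
    · rw [if_neg (by omega), if_neg h]; simp
  simp only [hval] at hint
  exact hint.unique (hasSum_ite_eq k _)

theorem IntervalIntegrable.complex_ofReal {f : ℝ → ℝ} {a b : ℝ}
    (h : IntervalIntegrable f volume a b) :
    IntervalIntegrable (fun x => (f x : ℂ)) volume a b :=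
  ⟨h.1.ofReal, h.2.ofReal⟩

theorem ae_one_sub_mul_exp_ne_zero (p : ℂ) :
    ∀ᵐ u : ℝ, 1 - p * Complex.exp (u * Complex.I) ≠ 0 := by
  rw [ae_iff]
  refine Set.Countable.measure_zero ?_ _
  rcases Set.eq_empty_or_nonempty {u : ℝ | ¬ (1 - p * Complex.exp (u * Complex.I) ≠ 0)} with h | ⟨v, hv⟩
  · exact h ▸ Set.countable_empty
  refine (Set.countable_range fun k : ℤ => v + k * (2 * π)).mono fun u hu => ?_
  simp only [ne_eq, not_not, Set.mem_ofPred_eq, sub_eq_zero] at hu hv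
  have hp : p ≠ 0 := by rintro rfl; simp at hv
  obtain ⟨k, hk⟩ := Complex.exp_eq_exp_iff_exists_int.mp (mul_left_cancel₀ hp (hu.symm.trans hv))
  refine ⟨k, ?_⟩
  have : ((u : ℂ)) = ((v + k * (2 * π) : ℝ) : ℂ) := by
    apply mul_right_cancel₀ Complex.I_ne_zero
    rw [hk]; push_cast; ring
  exact_mod_cast this.symm

theorem abs_log_norm_one_sub_mul_le {x : ℂ} (hx : ‖x‖ = 1) (hx1 : 1 - x ≠ 0) {ρ : ℝ}
    (h0 : 0 < ρ) (h1 : ρ < 1) : |log ‖1 - ρ * x‖| ≤ log 2 + |log ‖1 - x‖| := by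
  have hρ : ‖(ρ : ℂ) * x‖ = ρ := by simp [hx, abs_of_pos h0]
  have hlow : 1 - ρ ≤ ‖1 - ρ * x‖ := by
    have := norm_sub_norm_le (1 : ℂ) (ρ * x)
    rwa [norm_one, hρ] at this
  have hup : ‖1 - ρ * x‖ ≤ 2 := by
    have := norm_sub_le (1 : ℂ) (ρ * x)
    rw [norm_one, hρ] at this
    linarith
  have hx0 : 0 < ‖1 - x‖ := norm_pos_iff.mpr hx1
  have htri : ‖1 - x‖ ≤ 2 * ‖1 - ρ * x‖ := by
    have h : ‖1 - x‖ ≤ ‖1 - ρ * x‖ + ‖((1 - ρ : ℝ) : ℂ) * x‖ := by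
      refine le_trans (le_of_eq ?_) (norm_sub_le (1 - ρ * x) (((1 - ρ : ℝ) : ℂ) * x))
      congr 1; push_cast; ring
    rw [norm_mul, hx, mul_one, Complex.norm_real, norm_eq_abs, abs_of_pos (by linarith)] at h
    linarith
  have hpos : 0 < ‖1 - ρ * x‖ := by linarith
  have hl1 := Real.log_le_log hx0 htri
  rw [Real.log_mul two_ne_zero hpos.ne'] at hl1
  have hl2 := Real.log_le_log hpos hup
  rw [abs_le]
  constructor <;> linarith [neg_abs_le (log ‖1 - x‖), abs_nonneg (log ‖1 - x‖)]

theorem integral_log_norm_one_sub_mul_mul_exp {q : ℂ} (hq : ‖q‖ ≤ 1) {k : ℕ} (hk : k ≠ 0) :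
    ∫ u in (0:ℝ)..(2 * π), (log ‖1 - q * Complex.exp (u * Complex.I)‖ : ℂ) *
      Complex.exp (-(k : ℂ) * u * Complex.I) = -π * q ^ k / k := by
  rcases hq.lt_or_eq with hq | hq
  · exact integral_log_norm_one_sub_mul_mul_exp_of_lt hq hk
  have hevent : ∀ᶠ ρ : ℝ in nhdsWithin 1 (Set.Iio 1), 0 < ρ ∧ ρ < 1 :=
    (Filter.Eventually.filter_mono nhdsWithin_le_nhds (eventually_gt_nhds one_pos)).and
      self_mem_nhdsWithin
  have hexp : ∀ u : ℝ, ‖Complex.exp (-(k : ℂ) * u * Complex.I)‖ = 1 := fun u => by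
    rw [show -(k : ℂ) * u * Complex.I = ((-k * u : ℝ) : ℂ) * Complex.I by push_cast; ring]
    exact Complex.norm_exp_ofReal_mul_I _
  have hlim := intervalIntegral.tendsto_integral_filter_of_dominated_convergence (μ := volume)
    (a := 0) (b := 2 * π) (l := nhdsWithin (1 : ℝ) (Set.Iio 1))
    (F := fun (ρ u : ℝ) => (log ‖1 - ρ * q * Complex.exp (u * Complex.I)‖ : ℂ) *
      Complex.exp (-(k : ℂ) * u * Complex.I))
    (f := fun u : ℝ => (log ‖1 - q * Complex.exp (u * Complex.I)‖ : ℂ) *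
      Complex.exp (-(k : ℂ) * u * Complex.I))
    (fun u : ℝ => log 2 + |log ‖1 - q * Complex.exp (u * Complex.I)‖|)
    ?_ ?_ ?_ ?_
  · refine tendsto_nhds_unique (hlim.congr' ?_) (f := fun ρ : ℝ => -π * (ρ * q) ^ k / k) ?_
    · filter_upwards [hevent] with ρ hρ
      refine integral_log_norm_one_sub_mul_mul_exp_of_lt ?_ hk
      simp [hq, abs_of_pos hρ.1, hρ.2]
    · have : Continuous fun ρ : ℝ => -π * ((ρ : ℂ) * q) ^ k / k := by fun_prop
      simpa using (this.tendsto 1).mono_left nhdsWithin_le_nhds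
  · exact Eventually.of_forall fun ρ => Measurable.aestronglyMeasurable (by fun_prop)
  · filter_upwards [hevent] with ρ hρ
    filter_upwards [ae_one_sub_mul_exp_ne_zero q] with u hu _
    rw [norm_mul, hexp, mul_one, Complex.norm_real, norm_eq_abs, mul_assoc]
    exact abs_log_norm_one_sub_mul_le (by simp [hq, Complex.norm_exp_ofReal_mul_I]) hu hρ.1 hρ.2
  · exact intervalIntegrable_const.add (intervalIntegrable_log_norm_one_sub_mul q).abs
  · filter_upwards [ae_one_sub_mul_exp_ne_zero q] with u hu _
    refine Tendsto.mul_const _ ?_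
    refine (Complex.continuous_ofReal.tendsto _).comp ?_
    refine Tendsto.log ?_ (norm_ne_zero_iff.mpr hu)
    have : Continuous fun ρ : ℝ => ‖1 - ρ * q * Complex.exp (u * Complex.I)‖ := by fun_prop
    simpa using (this.tendsto 1).mono_left nhdsWithin_le_nhds

theorem integral_log_norm_one_sub_mul_mul_exp_of_one_le {p : ℂ} (hp : 1 ≤ ‖p‖) {k : ℕ}
    (hk : k ≠ 0) :
    ∫ u in (0:ℝ)..(2 * π), (log ‖1 - p * Complex.exp (u * Complex.I)‖ : ℂ) *
      Complex.exp (-(k : ℂ) * u * Complex.I) = -π * (star p)⁻¹ ^ k / k := by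
  have hp0 : p ≠ 0 := by rintro rfl; norm_num at hp
  have hsp : star p ≠ 0 := star_ne_zero.mpr hp0
  have hinv : ‖(star p)⁻¹‖ ≤ 1 := by rw [norm_inv, norm_star]; exact inv_le_one_of_one_le₀ hp
  have hfac : ∀ u : ℝ, ‖1 - p * Complex.exp (u * Complex.I)‖ =
      ‖p‖ * ‖1 - (star p)⁻¹ * Complex.exp (u * Complex.I)‖ := by
    intro u
    rw [norm_one_sub_mul_eq_norm_sub_star (Complex.norm_exp_ofReal_mul_I u), ← norm_star p,
      ← norm_mul, mul_sub, mul_inv_cancel_left₀ hsp, mul_one, norm_sub_rev]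
  rw [← integral_log_norm_one_sub_mul_mul_exp hinv hk]
  have hsplit : ∫ u in (0:ℝ)..(2 * π), (log ‖1 - p * Complex.exp (u * Complex.I)‖ : ℂ) *
      Complex.exp (-(k : ℂ) * u * Complex.I) = ∫ u in (0:ℝ)..(2 * π),
      ((log ‖p‖ : ℂ) * Complex.exp (((-k : ℤ) : ℂ) * u * Complex.I) +
      (log ‖1 - (star p)⁻¹ * Complex.exp (u * Complex.I)‖ : ℂ) *
        Complex.exp (-(k : ℂ) * u * Complex.I)) := by
    refine intervalIntegral.integral_congr_ae ?_
    filter_upwards [ae_one_sub_mul_exp_ne_zero (star p)⁻¹] with u hu _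
    rw [hfac, Real.log_mul (norm_ne_zero_iff.mpr hp0) (norm_ne_zero_iff.mpr hu)]
    push_cast
    ring
  rw [hsplit, intervalIntegral.integral_add, intervalIntegral.integral_const_mul,
    integral_exp_int_mul_I, if_neg (by omega), mul_zero, zero_add]
  · exact (by fun_prop : Continuous _).intervalIntegrable _ _
  · exact (intervalIntegrable_log_norm_one_sub_mul _).complex_ofReal.mul_continuousOn
      (by fun_prop : Continuous _).continuousOn

theorem intervalIntegrable_weight (L s a b : ℝ) : IntervalIntegrable (weight L s) volume a b := by
  have hmeas : Measurable (weight L s) :=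
    Measurable.ite (measurableSet_lt measurable_const Real.measurable_cos)
      measurable_const measurable_const
  refine (intervalIntegrable_const (c := max 1 |s|)).mono_fun hmeas.aestronglyMeasurable
    (Eventually.of_forall fun θ => ?_)
  simp only [weight, norm_eq_abs, abs_of_nonneg (a := max 1 |s|) (by positivity)]
  split_ifs <;> simp

theorem integral_norm_sq_mul_weight_le (L : ℝ) {s : ℝ} (hs : 0 ≤ s) {n : ℕ} {φ P : Polynomial ℂ}
    (hφ : φ.Monic) (hφn : φ.natDegree = n) (hP : P.Monic) (hPn : P.natDegree = n)
    (horth : ∀ k < n, (1 / (2 * (π:ℂ))) * ∫ θ in (0:ℝ)..(2 * π),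
        φ.eval (Complex.exp (θ * Complex.I)) * Complex.exp (-(k:ℂ) * θ * Complex.I) *
          (weight L s θ : ℂ) = 0) :
    ∫ θ in (0:ℝ)..(2 * π), ‖φ.eval (Complex.exp (θ * Complex.I))‖ ^ 2 * weight L s θ ≤
      ∫ θ in (0:ℝ)..(2 * π), ‖P.eval (Complex.exp (θ * Complex.I))‖ ^ 2 * weight L s θ := by
  have hw0 : ∀ θ, 0 ≤ weight L s θ := fun θ => by unfold weight; split_ifs <;> linarith
  have hint : ∀ f : ℝ → ℝ, Continuous f →
      IntervalIntegrable (fun θ => f θ * weight L s θ) volume 0 (2 * π) := fun f hf =>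
    (intervalIntegrable_weight L s _ _).continuousOn_mul hf.continuousOn
  have hintC : ∀ f : ℝ → ℂ, Continuous f →
      IntervalIntegrable (fun θ => f θ * (weight L s θ : ℂ)) volume 0 (2 * π) := fun f hf =>
    (intervalIntegrable_weight L s _ _).complex_ofReal.continuousOn_mul hf.continuousOn
  have horth' : ∀ k < n, ∫ θ in (0:ℝ)..(2 * π),
      φ.eval (Complex.exp (θ * Complex.I)) * Complex.exp (-(k:ℂ) * θ * Complex.I) *
          (weight L s θ : ℂ) = 0 := fun k hk => by
    simpa [pi_ne_zero] using horth k hk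
  have hev : ∀ Q : Polynomial ℂ, Continuous fun θ : ℝ => Q.eval (Complex.exp (θ * Complex.I)) :=
    fun Q => Q.continuous.comp (by fun_prop)
  set R := P - φ with hR
  have hRdeg : R.degree < n := by
    have := Polynomial.degree_sub_lt_left (p := P) (q := φ)
      (by rw [Polynomial.degree_eq_natDegree hP.ne_zero, Polynomial.degree_eq_natDegree hφ.ne_zero,
        hPn, hφn]) hP.ne_zero (by rw [hP.leadingCoeff, hφ.leadingCoeff])
    rwa [Polynomial.degree_eq_natDegree hP.ne_zero, hPn] at this
  have hReval : ∀ z, R.eval z = ∑ k ∈ Finset.range n, R.coeff k * z ^ k := by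
    intro z
    by_cases h : R = 0
    · simp [h]
    · exact Polynomial.eval_eq_sum_range' ((Polynomial.natDegree_lt_iff_degree_lt h).mpr hRdeg) z
  have hcross : ∫ θ in (0:ℝ)..(2 * π), φ.eval (Complex.exp (θ * Complex.I)) *
      star (R.eval (Complex.exp (θ * Complex.I))) * (weight L s θ : ℂ) = 0 := by
    have hexp : ∀ θ : ℝ, φ.eval (Complex.exp (θ * Complex.I)) *
        star (R.eval (Complex.exp (θ * Complex.I))) * (weight L s θ : ℂ) =
        ∑ k ∈ Finset.range n, star (R.coeff k) * (φ.eval (Complex.exp (θ * Complex.I)) *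
          Complex.exp (-(k:ℂ) * θ * Complex.I) * (weight L s θ : ℂ)) := by
      intro θ
      rw [hReval, star_sum, Finset.mul_sum, Finset.sum_mul]
      refine Finset.sum_congr rfl fun k _ => ?_
      have : star (Complex.exp (θ * Complex.I) ^ k) = Complex.exp (-(k:ℂ) * θ * Complex.I) := by
        rw [RCLike.star_def, ← Complex.exp_nat_mul, ← Complex.exp_conj]
        congr 1
        simp
        ring
      rw [star_mul, this]
      ring
    simp_rw [hexp]
    rw [intervalIntegral.integral_finsetSum]
    · refine Finset.sum_eq_zero fun k hk => ?_
      rw [intervalIntegral.integral_const_mul, horth' k (Finset.mem_range.mp hk), mul_zero]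
    · intro k _
      exact (hintC _ ((hev φ).mul (by fun_prop))).const_mul _
  have hre : ∫ θ in (0:ℝ)..(2 * π), (φ.eval (Complex.exp (θ * Complex.I)) *
      star (R.eval (Complex.exp (θ * Complex.I)))).re * weight L s θ = 0 := by
    have h := Complex.reCLM.intervalIntegral_comp_comm
      (hintC _ ((hev φ).mul (continuous_star.comp (hev R))))
    simp only [Function.comp_apply, Pi.mul_apply, hcross, map_zero, Complex.reCLM_apply,
      Complex.re_mul_ofReal] at h
    exact h
  have hsplit : ∫ θ in (0:ℝ)..(2 * π), ‖P.eval (Complex.exp (θ * Complex.I))‖ ^ 2 * weight L s θ =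
      (∫ θ in (0:ℝ)..(2 * π), ‖φ.eval (Complex.exp (θ * Complex.I))‖ ^ 2 * weight L s θ) +
      ((∫ θ in (0:ℝ)..(2 * π), ‖R.eval (Complex.exp (θ * Complex.I))‖ ^ 2 * weight L s θ) +
      2 * ∫ θ in (0:ℝ)..(2 * π), (φ.eval (Complex.exp (θ * Complex.I)) *
      star (R.eval (Complex.exp (θ * Complex.I)))).re * weight L s θ) := by
    have i1 : IntervalIntegrable (fun θ : ℝ => ‖φ.eval (Complex.exp (θ * Complex.I))‖ ^ 2 *
        weight L s θ) volume 0 (2 * π) := hint _ ((hev φ).norm.pow 2)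
    have i2 : IntervalIntegrable (fun θ : ℝ => ‖R.eval (Complex.exp (θ * Complex.I))‖ ^ 2 *
        weight L s θ) volume 0 (2 * π) := hint _ ((hev R).norm.pow 2)
    have i3 : IntervalIntegrable (fun θ : ℝ => 2 * ((φ.eval (Complex.exp (θ * Complex.I)) *
        star (R.eval (Complex.exp (θ * Complex.I)))).re * weight L s θ)) volume 0 (2 * π) :=
      (hint _ (Complex.continuous_re.comp
        ((hev φ).mul (continuous_star.comp (hev R))))).const_mul 2
    rw [← intervalIntegral.integral_const_mul, ← intervalIntegral.integral_add i2 i3,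
      ← intervalIntegral.integral_add i1 (i2.add i3)]
    refine intervalIntegral.integral_congr fun θ _ => ?_
    have hPe : P.eval (Complex.exp (θ * Complex.I)) = φ.eval (Complex.exp (θ * Complex.I)) +
        R.eval (Complex.exp (θ * Complex.I)) := by rw [hR]; simp
    simp only [hPe, ← Complex.normSq_eq_norm_sq, Complex.normSq_add, RCLike.star_def]
    ring
  rw [hsplit, hre]
  have : 0 ≤ ∫ θ in (0:ℝ)..(2 * π), ‖R.eval (Complex.exp (θ * Complex.I))‖ ^ 2 * weight L s θ :=
    intervalIntegral.integral_nonneg (by positivity) fun θ _ => mul_nonneg (by positivity) (hw0 θ)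
  linarith

theorem exists_add_mul_eq {c : ℂ} (hc : c ≠ 0) (z : ℂ) :
    ∃ p q : ℂ, c * (p + q) = z - 1 ∧ p * q = -z := by
  obtain ⟨d, hd⟩ := IsAlgClosed.exists_pow_nat_eq (((z - 1) / c) ^ 2 + 4 * z) two_pos
  refine ⟨((z - 1) / c + d) / 2, ((z - 1) / c - d) / 2, by field_simp; ring, ?_⟩
  linear_combination (-1 / 4 : ℂ) * hd

/-- The polynomials `c ^ n * (p ^ n + q ^ n)` in `z`, where `c * (p + q) = z - 1` and
`p * q = -z`. -/
noncomputable def arcPoly (c : ℂ) : ℕ → Polynomial ℂ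
  | 0 => Polynomial.C 2
  | 1 => Polynomial.X - Polynomial.C 1
  | n + 2 => (Polynomial.X - Polynomial.C 1) * arcPoly c (n + 1) +
      Polynomial.C (c ^ 2) * Polynomial.X * arcPoly c n

theorem arcPoly_eval {c z p q : ℂ} (hadd : c * (p + q) = z - 1) (hmul : p * q = -z) (n : ℕ) :
    (arcPoly c n).eval z = c ^ n * (p ^ n + q ^ n) := by
  induction n using Nat.twoStepInduction with
  | zero => simp [arcPoly]; norm_num
  | one => simp [arcPoly, hadd]
  | more n h0 h1 =>
    simp only [arcPoly, Polynomial.eval_add, Polynomial.eval_mul, Polynomial.eval_sub,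
      Polynomial.eval_X, Polynomial.eval_C, h0, h1]
    rw [← hadd, ← neg_eq_iff_eq_neg.mpr hmul]
    ring

theorem arcPoly_monic_natDegree (c : ℂ) (n : ℕ) :
    (arcPoly c (n + 1)).Monic ∧ (arcPoly c (n + 1)).natDegree = n + 1 := by
  suffices h : (arcPoly c n).natDegree ≤ n ∧ (arcPoly c (n + 1)).Monic ∧
      (arcPoly c (n + 1)).natDegree = n + 1 from h.2
  induction n with
  | zero =>
    refine ⟨by simp [arcPoly], ?_, ?_⟩
    · exact Polynomial.monic_X_sub_C 1
    · exact Polynomial.natDegree_X_sub_C 1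
  | succ n ih =>
    obtain ⟨h0, h1, h2⟩ := ih
    have hm : ((Polynomial.X - Polynomial.C 1) * arcPoly c (n + 1)).Monic :=
      (Polynomial.monic_X_sub_C 1).mul h1
    have hn : ((Polynomial.X - Polynomial.C 1) * arcPoly c (n + 1)).natDegree = n + 2 := by
      rw [(Polynomial.monic_X_sub_C 1).natDegree_mul h1, Polynomial.natDegree_X_sub_C, h2]
      omega
    have hlow : (Polynomial.C (c ^ 2) * Polynomial.X * arcPoly c n).natDegree < n + 2 := by
      refine lt_of_le_of_lt (Polynomial.natDegree_mul_le.trans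
        (add_le_add ((Polynomial.natDegree_C_mul_le _ _).trans Polynomial.natDegree_X_le) h0))
        (by omega)
    have hdeg : (Polynomial.C (c ^ 2) * Polynomial.X * arcPoly c n).degree <
        ((Polynomial.X - Polynomial.C 1) * arcPoly c (n + 1)).degree :=
      Polynomial.degree_lt_degree (by rw [hn]; exact hlow)
    refine ⟨h2.le, hm.add_of_left hdeg, ?_⟩
    rw [arcPoly, Polynomial.natDegree_add_eq_left_of_degree_lt hdeg, hn]

theorem norm_eq_one_or_im_eq_zero_of_add_inv_eq_ofReal {x : ℂ} {t : ℝ} (hx : x ≠ 0)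
    (h : x + x⁻¹ = t) : ‖x‖ = 1 ∨ x.im = 0 := by
  have him := congrArg Complex.im h
  simp only [Complex.add_im, Complex.inv_im, Complex.ofReal_im] at him
  have hn : Complex.normSq x ≠ 0 := Complex.normSq_eq_zero.not.mpr hx
  field_simp at him
  have : x.im * (Complex.normSq x - 1) = 0 := by linarith
  rcases mul_eq_zero.mp this with h | h
  · exact Or.inr h
  · left
    rw [Complex.normSq_eq_norm_sq] at h
    nlinarith [norm_nonneg x]

theorem exists_ofReal_eq_of_add_inv_eq_ofReal {x : ℂ} {t : ℝ} (hx : x ≠ 0)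
    (h : x + x⁻¹ = t) : ‖x‖ = 1 ∨ ‖x‖ + ‖x‖⁻¹ = |t| ∧ 2 ≤ |t| := by
  refine (norm_eq_one_or_im_eq_zero_of_add_inv_eq_ofReal hx h).imp_right fun him => ?_
  obtain ⟨y, rfl⟩ : ∃ y : ℝ, x = y := ⟨x.re, by apply Complex.ext <;> simp [him]⟩
  have hy : y ≠ 0 := by exact_mod_cast hx
  have ht : y + y⁻¹ = t := by exact_mod_cast h
  have hsum : |y| + |y|⁻¹ = |t| := by
    rw [← ht, ← abs_inv]
    rcases lt_or_gt_of_ne hy with hlt | hlt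
    · rw [abs_of_neg hlt, abs_of_neg (inv_lt_zero.mpr hlt),
        abs_of_neg (add_neg hlt (inv_lt_zero.mpr hlt))]
      ring
    · rw [abs_of_pos hlt, abs_of_pos (inv_pos.mpr hlt),
        abs_of_pos (add_pos hlt (inv_pos.mpr hlt))]
  refine ⟨by simpa using hsum, ?_⟩
  have hy0 : 0 < |y| := abs_pos.mpr hy
  rw [← hsum]
  have : 0 ≤ (|y| - 1) ^ 2 / |y| := by positivity
  have e : (|y| - 1) ^ 2 / |y| = |y| + |y|⁻¹ - 2 := by field_simp; ring
  linarith

theorem norm_le_inv_of_add_inv_eq_ofReal {x : ℂ} {t r : ℝ} (hx : x ≠ 0)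
    (h : x + x⁻¹ = t) (hr : 0 < r) (hr1 : r ≤ 1) (ht : |t| ≤ r + r⁻¹) : ‖x‖ ≤ r⁻¹ := by
  have h1 : 1 ≤ r⁻¹ := one_le_inv_iff₀.mpr ⟨hr, hr1⟩
  rcases exists_ofReal_eq_of_add_inv_eq_ofReal hx h with h | ⟨h, -⟩
  · rwa [h]
  · by_contra! hlt
    have hx0 : 0 < ‖x‖ := norm_pos_iff.mpr hx
    have : 0 < (‖x‖ - r⁻¹) * (1 - ‖x‖⁻¹ * r) := by
      refine mul_pos (by linarith) ?_
      rw [sub_pos, inv_mul_lt_iff₀ hx0]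
      linarith
    have e : (‖x‖ - r⁻¹) * (1 - ‖x‖⁻¹ * r) = ‖x‖ + ‖x‖⁻¹ - r - r⁻¹ := by field_simp; ring
    linarith

theorem exists_arcPoly_eval_exp {c : ℝ} (hc : 0 < c) (θ : ℝ) :
    ∃ x : ℂ, x ≠ 0 ∧ x + x⁻¹ = ((2 * sin (θ / 2) / c : ℝ) : ℂ) ∧ ∀ n,
      ‖(arcPoly c n).eval (Complex.exp (θ * Complex.I))‖ ≤ c ^ n * (‖x‖ ^ n + ‖x⁻¹‖ ^ n) := by
  have hc0 : (c : ℂ) ≠ 0 := by exact_mod_cast hc.ne'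
  obtain ⟨p, q, hadd, hmul⟩ := exists_add_mul_eq hc0 (Complex.exp (θ * Complex.I))
  set e := Complex.exp ((θ / 2 : ℝ) * Complex.I) with he
  have he0 : e ≠ 0 := Complex.exp_ne_zero _
  have hen : ‖e‖ = 1 := Complex.norm_exp_ofReal_mul_I _
  have hz : Complex.exp (θ * Complex.I) = e * e := by
    rw [he, ← Complex.exp_add]; congr 1; push_cast; ring
  have hp0 : p ≠ 0 := by
    rintro rfl
    rw [zero_mul, eq_comm, neg_eq_zero] at hmul
    exact Complex.exp_ne_zero _ hmul
  have hI := Complex.I_ne_zero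
  set x := p / (Complex.I * e) with hx
  have hx0 : x ≠ 0 := div_ne_zero hp0 (mul_ne_zero hI he0)
  have hq : x⁻¹ = q / (Complex.I * e) := by
    rw [hx, inv_div, div_eq_div_iff hp0 (mul_ne_zero hI he0), mul_comm q p, hmul, hz]
    linear_combination (e * e) * Complex.I_mul_I
  have hsin : 2 * (sin (θ / 2) : ℂ) * Complex.I * e = e * e - 1 := by
    have h1 : (sin (θ / 2) : ℂ) = (e⁻¹ - e) * Complex.I / 2 := by
      rw [Complex.ofReal_sin, Complex.sin, he, ← Complex.exp_neg]
      congr 3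
      ring_nf
    rw [h1]
    field_simp
    linear_combination (1 - e ^ 2) * Complex.I_sq
  refine ⟨x, hx0, ?_, fun n => ?_⟩
  · rw [hq, hx, ← add_div]
    push_cast at hsin ⊢
    rw [div_eq_div_iff (mul_ne_zero hI he0) hc0]
    linear_combination hadd + hz - hsin
  · rw [arcPoly_eval hadd hmul, norm_mul, norm_pow, Complex.norm_real, norm_eq_abs, abs_of_pos hc]
    have hpn : ‖p‖ = ‖x‖ := by rw [hx]; simp [hen]
    have hqn : ‖q‖ = ‖x⁻¹‖ := by rw [hq]; simp [hen]
    rw [← hpn, ← hqn, ← norm_pow, ← norm_pow]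
    gcongr
    exact norm_add_le _ _

theorem norm_arcPoly_sq_mul_weight_le {L : ℝ} (hL : L ∈ Set.Ioo 0 π) {s : ℝ} (hs : 0 ≤ s) {n : ℕ}
    (hsmall : s ≤ tan (L / 4) ^ (2 * n)) (θ : ℝ) :
    ‖(arcPoly (sin (L / 2) : ℝ) n).eval (Complex.exp (θ * Complex.I))‖ ^ 2 * weight L s θ ≤
      4 * sin (L / 2) ^ (2 * n) := by
  obtain ⟨h0, hπ⟩ := hL
  have hc : 0 < sin (L / 2) := sin_pos_of_pos_of_lt_pi (by linarith) (by linarith)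
  have hr : 0 < tan (L / 4) := tan_pos_of_pos_of_lt_pi_div_two (by linarith) (by linarith)
  have hr1 : tan (L / 4) ≤ 1 := by
    rw [← tan_pi_div_four]
    exact (tan_lt_tan_of_nonneg_of_lt_pi_div_two (by linarith) (by linarith) (by linarith)).le
  have hrc : tan (L / 4) + (tan (L / 4))⁻¹ = 2 / sin (L / 2) := by
    have hs4 : sin (L / 4) ≠ 0 := (sin_pos_of_pos_of_lt_pi (by linarith) (by linarith)).ne'
    have hc4 : cos (L / 4) ≠ 0 := (cos_pos_of_mem_Ioo ⟨by linarith, by linarith⟩).ne'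
    rw [show L / 2 = 2 * (L / 4) by ring, sin_two_mul, tan_eq_sin_div_cos]
    field_simp
    exact sin_sq_add_cos_sq _
  obtain ⟨x, hx, hxt, hP⟩ := exists_arcPoly_eval_exp hc θ
  have hxt' : x⁻¹ + x⁻¹⁻¹ = ((2 * sin (θ / 2) / sin (L / 2) : ℝ) : ℂ) := by
    rw [inv_inv, add_comm, hxt]
  have hkey : ∀ M : ℝ, ‖x‖ ≤ M → ‖x⁻¹‖ ≤ M →
      ‖(arcPoly (sin (L / 2) : ℝ) n).eval (Complex.exp (θ * Complex.I))‖ ^ 2 ≤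
        4 * sin (L / 2) ^ (2 * n) * M ^ (2 * n) := by
    intro M h1 h2
    have hM : 0 ≤ M := (norm_nonneg _).trans h1
    calc _ ≤ (sin (L / 2) ^ n * (M ^ n + M ^ n)) ^ 2 := by
          refine pow_le_pow_left₀ (norm_nonneg _) ((hP n).trans ?_) 2
          gcongr
      _ = _ := by ring
  unfold weight
  split_ifs with hcos
  · have hlt : |2 * sin (θ / 2) / sin (L / 2)| < 2 := by
      rw [abs_div, abs_of_pos hc, div_lt_iff₀ hc, abs_mul, abs_two]
      have h1 : cos θ = 1 - 2 * sin (θ / 2) ^ 2 := by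
        rw [show θ = 2 * (θ / 2) by ring, cos_two_mul, cos_sq']; ring_nf
      have h2 : cos L = 1 - 2 * sin (L / 2) ^ 2 := by
        rw [show L = 2 * (L / 2) by ring, cos_two_mul, cos_sq']; ring_nf
      have : |sin (θ / 2)| < |sin (L / 2)| := sq_lt_sq.mp (by linarith)
      rw [abs_of_pos hc] at this
      linarith
    have hx1 : ‖x‖ = 1 := by
      rcases exists_ofReal_eq_of_add_inv_eq_ofReal hx hxt with h | h
      · exact h
      · exact absurd h.2 (not_le.mpr hlt)
    simpa using hkey 1 hx1.le (by rw [norm_inv, hx1, inv_one])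
  · have hle : |2 * sin (θ / 2) / sin (L / 2)| ≤ tan (L / 4) + (tan (L / 4))⁻¹ := by
      rw [hrc, abs_div, abs_of_pos hc, abs_mul, abs_two]
      gcongr
      linarith [abs_sin_le_one (θ / 2)]
    have hb := hkey _ (norm_le_inv_of_add_inv_eq_ofReal hx hxt hr hr1 hle)
      (norm_le_inv_of_add_inv_eq_ofReal (inv_ne_zero hx) hxt' hr hr1 hle)
    calc _ ≤ (4 * sin (L / 2) ^ (2 * n) * (tan (L / 4))⁻¹ ^ (2 * n)) * tan (L / 4) ^ (2 * n) := by
          gcongr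
      _ = 4 * sin (L / 2) ^ (2 * n) := by
          rw [mul_assoc, ← mul_pow, inv_mul_cancel₀ hr.ne', one_pow, mul_one]

theorem integral_norm_sq_le_of_orthogonal {L : ℝ} (hL : L ∈ Set.Ioo 0 π) {s : ℝ} (hs : 0 ≤ s)
    {n : ℕ} (hn : n ≠ 0) (hsmall : s ≤ tan (L / 4) ^ (2 * n)) {φ : Polynomial ℂ}
    (hφ : φ.Monic) (hφn : φ.natDegree = n)
    (horth : ∀ k < n, (1 / (2 * (π:ℂ))) * ∫ θ in (0:ℝ)..(2 * π),
        φ.eval (Complex.exp (θ * Complex.I)) * Complex.exp (-(k:ℂ) * θ * Complex.I) *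
          (weight L s θ : ℂ) = 0) :
    ∫ θ in (-L)..L, ‖φ.eval (Complex.exp (θ * Complex.I))‖ ^ 2 ≤ 8 * π * sin (L / 2) ^ (2 * n) := by
  obtain ⟨m, rfl⟩ := Nat.exists_eq_succ_of_ne_zero hn
  obtain ⟨hPm, hPn⟩ := arcPoly_monic_natDegree (sin (L / 2) : ℝ) m
  have hmin := integral_norm_sq_mul_weight_le L hs hφ hφn hPm hPn horth
  have hev : ∀ Q : Polynomial ℂ, Continuous fun θ : ℝ => Q.eval (Complex.exp (θ * Complex.I)) :=
    fun Q => Q.continuous.comp (by fun_prop)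
  have hint : ∀ (Q : Polynomial ℂ) (a b : ℝ), IntervalIntegrable (fun θ : ℝ =>
      ‖Q.eval (Complex.exp (θ * Complex.I))‖ ^ 2 * weight L s θ) volume a b := fun Q a b =>
    (intervalIntegrable_weight L s a b).continuousOn_mul ((hev Q).norm.pow 2).continuousOn
  have hupper : ∫ θ in (0:ℝ)..(2 * π), ‖(arcPoly (sin (L / 2) : ℝ) (m + 1)).eval
      (Complex.exp (θ * Complex.I))‖ ^ 2 * weight L s θ ≤
      8 * π * sin (L / 2) ^ (2 * (m + 1)) := by
    calc _ ≤ ∫ _ in (0:ℝ)..(2 * π), 4 * sin (L / 2) ^ (2 * (m + 1)) :=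
          intervalIntegral.integral_mono_on (by positivity) (hint _ _ _) intervalIntegrable_const
            fun θ _ => norm_arcPoly_sq_mul_weight_le hL hs hsmall θ
      _ = _ := by rw [intervalIntegral.integral_const, smul_eq_mul]; ring
  have hper : Function.Periodic (fun θ : ℝ => ‖φ.eval (Complex.exp (θ * Complex.I))‖ ^ 2 *
      weight L s θ) (2 * π) := by
    intro θ
    have : Complex.exp (((θ + 2 * π : ℝ) : ℂ) * Complex.I) = Complex.exp (θ * Complex.I) := by
      rw [← Complex.exp_periodic (θ * Complex.I)]
      congr 1
      push_cast
      ring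
    simp only [this, weight, cos_add_two_pi]
  have hshift := hper.intervalIntegral_add_eq 0 (-π)
  rw [zero_add, show -π + 2 * π = π by ring] at hshift
  refine le_trans ?_ (hmin.trans hupper)
  rw [hshift]
  have hL' := hL
  obtain ⟨h0, hπ⟩ := hL'
  have hw0 : ∀ θ, 0 ≤ weight L s θ := fun θ => by unfold weight; split_ifs <;> linarith
  calc ∫ θ in (-L)..L, ‖φ.eval (Complex.exp (θ * Complex.I))‖ ^ 2
      = ∫ θ in (-L)..L, ‖φ.eval (Complex.exp (θ * Complex.I))‖ ^ 2 * weight L s θ := by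
        refine intervalIntegral.integral_congr_ae ?_
        filter_upwards [(Set.countable_singleton L).ae_notMem volume] with θ hθ hmem
        rw [Set.uIoc_of_le (by linarith)] at hmem
        have hlt : θ < L := lt_of_le_of_ne hmem.2 hθ
        have : cos L < cos θ := by
          rw [← cos_abs θ]
          exact cos_lt_cos_of_nonneg_of_le_pi (abs_nonneg θ) hπ.le (abs_lt.mpr ⟨hmem.1, hlt⟩)
        rw [weight, if_pos this, mul_one]
    _ ≤ _ := by
        refine intervalIntegral.integral_mono_interval (by linarith) (by linarith) (by linarith)
          (Eventually.of_forall fun θ => mul_nonneg (by positivity) (hw0 θ)) (hint _ _ _)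

/-- The conformal map from the unit disk onto the complement of the arc
`{exp (iθ) : |sin (θ / 2)| ≤ c}`, taking `0` to `∞`. -/
noncomputable def arcMap (c : ℝ) (η : ℂ) : ℂ := (η + c) / (η * (1 + c * η))

/-- Half the argument of the points of the arc `{exp (iθ) : |sin (θ / 2)| ≤ c}`, in the coordinate
that makes the equilibrium measure uniform. -/
noncomputable def arcAngle (c w : ℝ) : ℝ := arcsin (c * sin w)

theorem abs_mul_sin_lt_one {c : ℝ} (hc : 0 < c) (hc1 : c < 1) (w : ℝ) : |c * sin w| < 1 := by
  rw [abs_mul, abs_of_pos hc]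
  nlinarith [abs_sin_le_one w, abs_nonneg (sin w)]

theorem sin_arcAngle {c : ℝ} (hc : 0 < c) (hc1 : c < 1) (w : ℝ) :
    sin (arcAngle c w) = c * sin w := by
  have := abs_lt.mp (abs_mul_sin_lt_one hc hc1 w)
  exact sin_arcsin this.1.le this.2.le

theorem cos_arcAngle_pos {c : ℝ} (hc : 0 < c) (hc1 : c < 1) (w : ℝ) : 0 < cos (arcAngle c w) := by
  have := abs_lt.mp (abs_mul_sin_lt_one hc hc1 w)
  exact cos_pos_of_mem_Ioo ⟨neg_pi_div_two_lt_arcsin.mpr this.1, arcsin_lt_pi_div_two.mpr this.2⟩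

theorem hasDerivAt_arcAngle {c : ℝ} (hc : 0 < c) (hc1 : c < 1) (w : ℝ) :
    HasDerivAt (arcAngle c) (c * cos w / cos (arcAngle c w)) w := by
  have h := abs_lt.mp (abs_mul_sin_lt_one hc hc1 w)
  have := (hasDerivAt_arcsin h.1.ne' h.2.ne).comp w ((hasDerivAt_sin w).const_mul c)
  refine this.congr_deriv ?_
  rw [arcAngle, cos_arcsin]
  ring

theorem continuous_arcAngle (c : ℝ) : Continuous (arcAngle c) :=
  continuous_arcsin.comp (by fun_prop)

theorem continuous_deriv_arcAngle {c : ℝ} (hc : 0 < c) (hc1 : c < 1) :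
    Continuous fun w => c * cos w / cos (arcAngle c w) :=
  (by fun_prop : Continuous fun w => c * cos w).div (continuous_cos.comp (continuous_arcAngle c))
    fun w => (cos_arcAngle_pos hc hc1 w).ne'

theorem one_add_mul_ne_zero {c : ℝ} (hc : 0 < c) (hc1 : c < 1) {η : ℂ} (hη : ‖η‖ ≤ 1) :
    1 + c * η ≠ 0 := by
  intro h
  have h2 : ‖(c : ℂ) * η‖ = 1 := by rw [eq_neg_of_add_eq_zero_right h]; simp
  rw [norm_mul, Complex.norm_real, norm_eq_abs, abs_of_pos hc] at h2
  nlinarith [norm_nonneg η]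

theorem arcMap_exp_neg {c : ℝ} (hc : 0 < c) (hc1 : c < 1) (w : ℝ) :
    arcMap c (Complex.exp ((-(w + arcAngle c w) : ℝ) * Complex.I)) =
      Complex.exp ((2 * arcAngle c w : ℝ) * Complex.I) := by
  have hne := one_add_mul_ne_zero hc hc1
    (Complex.norm_exp_ofReal_mul_I (-(w + arcAngle c w))).le
  set a := Complex.exp (arcAngle c w * Complex.I) with ha
  set b := Complex.exp (w * Complex.I) with hb
  have ha0 : a ≠ 0 := Complex.exp_ne_zero _
  have hb0 : b ≠ 0 := Complex.exp_ne_zero _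
  have hη : Complex.exp ((-(w + arcAngle c w) : ℝ) * Complex.I) = (a * b)⁻¹ := by
    rw [ha, hb, ← Complex.exp_add, ← Complex.exp_neg]; congr 1; push_cast; ring
  have hz : Complex.exp ((2 * arcAngle c w : ℝ) * Complex.I) = a * a := by
    rw [ha, ← Complex.exp_add]; congr 1; push_cast; ring
  have hsa : ((sin (arcAngle c w) : ℝ) : ℂ) = (a⁻¹ - a) * Complex.I / 2 := by
    rw [Complex.ofReal_sin, Complex.sin, ha, ← Complex.exp_neg]; congr 3; ring_nf
  have hsb : ((sin w : ℝ) : ℂ) = (b⁻¹ - b) * Complex.I / 2 := by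
    rw [Complex.ofReal_sin, Complex.sin, hb, ← Complex.exp_neg]; congr 3; ring_nf
  have hrel : (a⁻¹ - a) = c * (b⁻¹ - b) := by
    have h := congrArg (fun x : ℝ => (x : ℂ)) (sin_arcAngle hc hc1 w)
    simp only [Complex.ofReal_mul] at h
    rw [hsa, hsb] at h
    apply mul_right_cancel₀ Complex.I_ne_zero
    linear_combination 2 * h
  rw [hη] at hne
  rw [arcMap, hη, hz, div_eq_iff (mul_ne_zero (inv_ne_zero (mul_ne_zero ha0 hb0)) hne)]
  field_simp at hrel ⊢
  linear_combination hrel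

theorem continuous_arcMap_exp {c : ℝ} (hc : 0 < c) (hc1 : c < 1) :
    Continuous fun u : ℝ => arcMap c (Complex.exp (u * Complex.I)) := by
  refine Continuous.div (by fun_prop) (by fun_prop) fun u => mul_ne_zero (Complex.exp_ne_zero _) ?_
  exact one_add_mul_ne_zero hc hc1 (Complex.norm_exp_ofReal_mul_I u).le

theorem integral_arcMap_exp {c : ℝ} (hc : 0 < c) (hc1 : c < 1) {H : ℂ → ℝ} (hH : Continuous H) :
    ∫ u in (0:ℝ)..(2 * π), H (arcMap c (Complex.exp (u * Complex.I))) =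
      2 * ∫ w in (-(π / 2))..(π / 2), H (Complex.exp ((2 * arcAngle c w : ℝ) * Complex.I)) := by
  set h : ℝ → ℝ := fun u => H (arcMap c (Complex.exp (u * Complex.I))) with hh
  set K : ℝ → ℝ := fun x => H (Complex.exp ((2 * x : ℝ) * Complex.I)) with hK
  have hhc : Continuous h := hH.comp (continuous_arcMap_exp hc hc1)
  have hKc : Continuous K := hH.comp (by fun_prop)
  have hper : Function.Periodic h (2 * π) := by
    intro u
    have : Complex.exp (((u + 2 * π : ℝ) : ℂ) * Complex.I) = Complex.exp (u * Complex.I) := by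
      rw [← Complex.exp_periodic (u * Complex.I)]; congr 1; push_cast; ring
    simp only [hh, this]
  have hα := continuous_arcAngle c
  have hα' := continuous_deriv_arcAngle hc hc1
  have hαπ : arcAngle c π = 0 := by simp [arcAngle]
  have hαπ' : arcAngle c (-π) = 0 := by simp [arcAngle]
  have h1 : ∫ u in (0:ℝ)..(2 * π), h u = ∫ u in (-π)..π, h (-u) := by
    have := hper.intervalIntegral_add_eq 0 (-π)
    rw [zero_add, show -π + 2 * π = π by ring] at this
    rw [this, intervalIntegral.integral_comp_neg, neg_neg]
  have h2 : ∫ u in (-π)..π, h (-u) =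
      ∫ w in (-π)..π, K (arcAngle c w) * (1 + c * cos w / cos (arcAngle c w)) := by
    have := intervalIntegral.integral_comp_mul_deriv (a := -π) (b := π)
      (f := fun w => w + arcAngle c w) (f' := fun w => 1 + c * cos w / cos (arcAngle c w))
      (g := fun u => h (-u)) (fun w _ => (hasDerivAt_id w).add (hasDerivAt_arcAngle hc hc1 w))
      (continuous_const.add hα').continuousOn (hhc.comp continuous_neg)
    simp only [hαπ, hαπ', add_zero] at this
    rw [← this]
    refine intervalIntegral.integral_congr fun w _ => ?_
    simp only [Function.comp_apply, hh, hK, arcMap_exp_neg hc hc1]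
  have h3 : ∫ w in (-π)..π, K (arcAngle c w) * (c * cos w / cos (arcAngle c w)) = 0 := by
    have := intervalIntegral.integral_comp_mul_deriv (a := -π) (b := π)
      (f := arcAngle c) (g := K) (fun w _ => hasDerivAt_arcAngle hc hc1 w) hα'.continuousOn hKc
    simpa [hαπ, hαπ'] using this
  have hKα : Continuous fun w => K (arcAngle c w) := hKc.comp hα
  have h4 : ∫ w in (-π)..π, K (arcAngle c w) =
      2 * ∫ w in (-(π / 2))..(π / 2), K (arcAngle c w) := by
    have hper' : Function.Periodic (fun w => K (arcAngle c w)) (2 * π) := fun w => by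
      simp only [arcAngle, sin_add_two_pi]
    have e1 := hper'.intervalIntegral_add_eq (-π) (-(π / 2))
    rw [show -π + 2 * π = π by ring] at e1
    rw [e1, ← intervalIntegral.integral_add_adjacent_intervals (b := π / 2)
      (hKα.intervalIntegrable _ _) (hKα.intervalIntegrable _ _)]
    have e2 := intervalIntegral.integral_comp_sub_left (a := -(π / 2)) (b := π / 2)
      (fun w => K (arcAngle c w)) π
    rw [show π - -(π / 2) = -(π / 2) + 2 * π by ring, show π - π / 2 = π / 2 by ring] at e2
    rw [← e2]
    simp only [arcAngle, sin_pi_sub]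
    ring
  have hKα' : IntervalIntegrable
      (fun w => K (arcAngle c w) * (c * cos w / cos (arcAngle c w))) volume (-π) π :=
    (hKα.mul hα').intervalIntegrable _ _
  rw [h1, h2, ← h4]
  simp only [mul_add, mul_one]
  rw [intervalIntegral.integral_add (hKα.intervalIntegrable _ _)
    hKα', h3, add_zero]

theorem sin_half_mem_Ioo {L : ℝ} (hL : L ∈ Set.Ioo 0 π) : sin (L / 2) ∈ Set.Ioo 0 1 := by
  refine ⟨sin_pos_of_pos_of_lt_pi (by linarith [hL.1]) (by linarith [hL.2, pi_pos]), ?_⟩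
  have := sin_lt_sin_of_lt_of_le_pi_div_two (by linarith [hL.1, pi_pos]) le_rfl
    (show L / 2 < π / 2 by linarith [hL.2])
  rwa [sin_pi_div_two] at this

theorem image_two_mul_arcAngle {L : ℝ} (hL : L ∈ Set.Ioo 0 π) :
    (fun w => 2 * arcAngle (sin (L / 2)) w) '' Set.Ioo (-(π / 2)) (π / 2) = Set.Ioo (-L) L := by
  obtain ⟨hc, hc1⟩ := sin_half_mem_Ioo hL
  have hL2 : arcsin (sin (L / 2)) = L / 2 :=
    arcsin_sin (by linarith [hL.1, pi_pos]) (by linarith [hL.2])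
  ext θ
  constructor
  · rintro ⟨w, hw, rfl⟩
    have hs1 : sin w < 1 := by
      have := sin_lt_sin_of_lt_of_le_pi_div_two hw.1.le le_rfl hw.2
      rwa [sin_pi_div_two] at this
    have hs2 : -1 < sin w := by
      have := sin_lt_sin_of_lt_of_le_pi_div_two le_rfl hw.2.le hw.1
      rwa [sin_neg, sin_pi_div_two] at this
    have hL3 : arcsin (-sin (L / 2)) = -(L / 2) := by rw [arcsin_neg, hL2]
    have h1 : arcAngle (sin (L / 2)) w < L / 2 := by
      refine lt_of_lt_of_eq ?_ hL2
      exact arcsin_lt_arcsin (by nlinarith) (by nlinarith) hc1.le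
    have h2 : -(L / 2) < arcAngle (sin (L / 2)) w := by
      refine lt_of_eq_of_lt hL3.symm ?_
      exact arcsin_lt_arcsin (by nlinarith) (by nlinarith) (by nlinarith)
    constructor <;> simp only <;> linarith
  · intro hθ
    have h1 : sin (θ / 2) < sin (L / 2) :=
      sin_lt_sin_of_lt_of_le_pi_div_two (by linarith [hθ.1, hL.2]) (by linarith [hL.2])
        (by linarith [hθ.2])
    have h2 : -sin (L / 2) < sin (θ / 2) := by
      rw [← sin_neg]
      exact sin_lt_sin_of_lt_of_le_pi_div_two (by linarith [hL.2]) (by linarith [hL.2, hθ.2])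
        (by linarith [hθ.1])
    have h3 : sin (θ / 2) / sin (L / 2) < 1 := (div_lt_one hc).mpr h1
    have h4 : -1 < sin (θ / 2) / sin (L / 2) := by rw [lt_div_iff₀ hc]; linarith
    refine ⟨arcsin (sin (θ / 2) / sin (L / 2)),
      ⟨neg_pi_div_two_lt_arcsin.mpr h4, arcsin_lt_pi_div_two.mpr h3⟩, ?_⟩
    simp only [arcAngle]
    rw [sin_arcsin h4.le h3.le, mul_div_cancel₀ _ hc.ne',
      arcsin_sin (by linarith [hθ.1, hL.2]) (by linarith [hθ.2, hL.2])]
    ring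

theorem injOn_two_mul_arcAngle {c : ℝ} (hc : 0 < c) (hc1 : c < 1) :
    Set.InjOn (fun w => 2 * arcAngle c w) (Set.Ioo (-(π / 2)) (π / 2)) := by
  intro x hx y hy hxy
  have h : sin (arcAngle c x) = sin (arcAngle c y) := by
    rw [mul_left_cancel₀ two_ne_zero hxy]
  rw [sin_arcAngle hc hc1, sin_arcAngle hc hc1] at h
  exact injOn_sin ⟨hx.1.le, hx.2.le⟩ ⟨hy.1.le, hy.2.le⟩ (mul_left_cancel₀ hc.ne' h)

theorem sqrt_arc_density {L w : ℝ} (hc : 0 < sin (L / 2)) (hc1 : sin (L / 2) < 1)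
    (hw : w ∈ Set.Ioo (-(π / 2)) (π / 2)) :
    √((cos (2 * arcAngle (sin (L / 2)) w) + 1) / (cos (2 * arcAngle (sin (L / 2)) w) - cos L)) =
      cos (arcAngle (sin (L / 2)) w) / (sin (L / 2) * cos w) := by
  have hcw := cos_pos_of_mem_Ioo hw
  have hca := cos_arcAngle_pos hc hc1 w
  have hs := sin_arcAngle hc hc1 w
  set a := arcAngle (sin (L / 2)) w
  have h1 : cos (2 * a) + 1 = 2 * cos a ^ 2 := by rw [cos_two_mul]; ring
  have h2 : cos (2 * a) - cos L = 2 * (sin (L / 2) * cos w) ^ 2 := by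
    have h3 : cos L = 1 - 2 * sin (L / 2) ^ 2 := by
      rw [← cos_two_mul_eq_one_sub]; ring_nf
    rw [h3, cos_two_mul_eq_one_sub, hs, mul_pow, mul_pow, cos_sq']
    ring
  rw [h1, h2, mul_div_mul_left _ _ two_ne_zero, ← div_pow, sqrt_sq (by positivity)]

theorem integral_arc_density {L : ℝ} (hL : L ∈ Set.Ioo 0 π) {H : ℂ → ℝ} (hH : Continuous H) :
    ∫ θ in (-L)..L, H (Complex.exp (θ * Complex.I)) *
        ((1 / (2 * π)) * √((cos θ + 1) / (cos θ - cos L))) =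
      (1 / (2 * π)) * ∫ u in (0:ℝ)..(2 * π),
        H (arcMap (sin (L / 2)) (Complex.exp (u * Complex.I))) := by
  obtain ⟨hc, hc1⟩ := sin_half_mem_Ioo hL
  have hder : ∀ w ∈ Set.Ioo (-(π / 2)) (π / 2),
      HasDerivWithinAt (fun w => 2 * arcAngle (sin (L / 2)) w)
        (2 * (sin (L / 2) * cos w / cos (arcAngle (sin (L / 2)) w)))
        (Set.Ioo (-(π / 2)) (π / 2)) w := fun w _ =>
    ((hasDerivAt_arcAngle hc hc1 w).const_mul 2).hasDerivWithinAt
  have hcov := integral_image_eq_integral_abs_deriv_smul measurableSet_Ioo hder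
    (injOn_two_mul_arcAngle hc hc1) fun θ : ℝ => H (Complex.exp (θ * Complex.I)) *
        ((1 / (2 * π)) * √((cos θ + 1) / (cos θ - cos L)))
  rw [image_two_mul_arcAngle hL] at hcov
  rw [integral_arcMap_exp hc hc1 hH, intervalIntegral.integral_of_le (by linarith [hL.1]),
    intervalIntegral.integral_of_le (by linarith [pi_pos]), integral_Ioc_eq_integral_Ioo, hcov,
    integral_Ioc_eq_integral_Ioo, ← integral_const_mul, ← integral_const_mul]
  refine setIntegral_congr_fun measurableSet_Ioo fun w hw => ?_
  have hcw := cos_pos_of_mem_Ioo hw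
  have hca := cos_arcAngle_pos hc hc1 w
  simp only [smul_eq_mul]
  rw [sqrt_arc_density hc hc1 hw, abs_of_pos (by positivity)]
  field_simp

theorem log_one_add_le_mul_sub_log {x y : ℝ} (hx : 0 ≤ x) (hy : 0 < y) (hy1 : y ≤ 1) :
    log (1 + x) ≤ x * y - log y := by
  have h1 : log ((1 + x) * y) = log (1 + x) + log y := log_mul (by positivity) hy.ne'
  have h2 := log_le_sub_one_of_pos (show 0 < (1 + x) * y by positivity)
  nlinarith

theorem integral_arcAngle_mul_cos_le {L : ℝ} (hL : L ∈ Set.Ioo 0 π) {X : ℂ → ℝ}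
    (hX : Continuous X) (hX0 : ∀ z, 0 ≤ X z) :
    ∫ w in (-(π / 2))..(π / 2),
        X (Complex.exp ((2 * arcAngle (sin (L / 2)) w : ℝ) * Complex.I)) * cos w ≤
      (2 * sin (L / 2))⁻¹ * ∫ θ in (-L)..L, X (Complex.exp (θ * Complex.I)) := by
  obtain ⟨hc, hc1⟩ := sin_half_mem_Ioo hL
  have hα := continuous_arcAngle (sin (L / 2))
  have hα' := continuous_deriv_arcAngle hc hc1
  have hXα : Continuous fun w : ℝ =>
      X (Complex.exp ((2 * arcAngle (sin (L / 2)) w : ℝ) * Complex.I)) := by fun_prop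
  have hsub := intervalIntegral.integral_comp_mul_deriv (a := -(π / 2)) (b := π / 2)
    (f := arcAngle (sin (L / 2))) (g := fun x : ℝ => X (Complex.exp ((2 * x : ℝ) * Complex.I)))
    (fun w _ => hasDerivAt_arcAngle hc hc1 w) hα'.continuousOn (by fun_prop)
  have hend : arcAngle (sin (L / 2)) (π / 2) = L / 2 := by
    rw [arcAngle, sin_pi_div_two, mul_one,
      arcsin_sin (by linarith [hL.1, pi_pos]) (by linarith [hL.2])]
  have hend' : arcAngle (sin (L / 2)) (-(π / 2)) = -(L / 2) := by
    rw [arcAngle, sin_neg, mul_neg, arcsin_neg, ← arcAngle, hend]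
  have hscale := intervalIntegral.integral_comp_mul_left (a := -(L / 2)) (b := L / 2)
    (fun θ : ℝ => X (Complex.exp (θ * Complex.I))) (two_ne_zero (α := ℝ))
  rw [hend, hend', hscale, show 2 * -(L / 2) = -L by ring, show 2 * (L / 2) = L by ring,
    smul_eq_mul] at hsub
  rw [mul_inv, mul_comm (2:ℝ)⁻¹, mul_assoc, ← hsub, ← intervalIntegral.integral_const_mul]
  refine intervalIntegral.integral_mono_on_of_le_Ioo (by linarith [pi_pos])
    ((hXα.mul continuous_cos).intervalIntegrable _ _)
    ((continuous_const.mul (hXα.mul hα')).intervalIntegrable _ _) fun w hw => ?_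
  have hcw := cos_pos_of_mem_Ioo hw
  have hca := cos_arcAngle_pos hc hc1 w
  have hX := hX0 (Complex.exp ((2 * arcAngle (sin (L / 2)) w : ℝ) * Complex.I))
  have hle : cos w ≤ cos w / cos (arcAngle (sin (L / 2)) w) :=
    le_div_self hcw.le hca (cos_le_one _)
  calc _ ≤ X (Complex.exp ((2 * arcAngle (sin (L / 2)) w : ℝ) * Complex.I)) *
        (cos w / cos (arcAngle (sin (L / 2)) w)) := mul_le_mul_of_nonneg_left hle hX
    _ = _ := by simp only [Function.comp_apply]; field_simp

theorem integral_log_one_add_arcMap_le {L : ℝ} (hL : L ∈ Set.Ioo 0 π) {X : ℂ → ℝ}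
    (hX : Continuous X) (hX0 : ∀ z, 0 ≤ X z) :
    ∫ u in (0:ℝ)..(2 * π), log (1 + X (arcMap (sin (L / 2)) (Complex.exp (u * Complex.I)))) ≤
      (sin (L / 2))⁻¹ * (∫ θ in (-L)..L, X (Complex.exp (θ * Complex.I))) -
        2 * ∫ w in (-(π / 2))..(π / 2), log (cos w) := by
  obtain ⟨hc, hc1⟩ := sin_half_mem_Ioo hL
  have hα := continuous_arcAngle (sin (L / 2))
  have hXα : Continuous fun w : ℝ =>
      X (Complex.exp ((2 * arcAngle (sin (L / 2)) w : ℝ) * Complex.I)) := by fun_prop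
  have hlog : Continuous fun z => log (1 + X z) :=
    (continuous_const.add hX).log fun z => (by linarith [hX0 z] : (0:ℝ) < 1 + X z).ne'
  have i1 : IntervalIntegrable (fun w : ℝ =>
      X (Complex.exp ((2 * arcAngle (sin (L / 2)) w : ℝ) * Complex.I)) * cos w) volume
      (-(π / 2)) (π / 2) := (hXα.mul continuous_cos).intervalIntegrable _ _
  have i2 : IntervalIntegrable (fun w => log (cos w)) volume (-(π / 2)) (π / 2) :=
    intervalIntegrable_log_cos
  have hmono := intervalIntegral.integral_mono_on_of_le_Ioo
    (f := fun w : ℝ =>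
      log (1 + X (Complex.exp ((2 * arcAngle (sin (L / 2)) w : ℝ) * Complex.I))))
    (by linarith [pi_pos] : -(π / 2) ≤ π / 2)
    ((hlog.comp (by fun_prop : Continuous fun w : ℝ =>
      Complex.exp ((2 * arcAngle (sin (L / 2)) w : ℝ) * Complex.I))).intervalIntegrable _ _)
    (i1.sub i2) fun w hw =>
      log_one_add_le_mul_sub_log (hX0 _) (cos_pos_of_mem_Ioo hw) (cos_le_one w)
  rw [intervalIntegral.integral_sub i1 i2] at hmono
  have hle := integral_arcAngle_mul_cos_le hL hX hX0
  rw [integral_arcMap_exp hc hc1 hlog]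
  rw [mul_inv] at hle
  linarith

/-- The inverses `p`, `q` of the two preimages of `z` under `arcMap c`, with `p` outside the open
unit disk and `q` in the closed unit disk. -/
structure IsArcPair (c : ℝ) (z p q : ℂ) : Prop where
  one_le_norm : 1 ≤ ‖p‖
  norm_le_one : ‖q‖ ≤ 1
  mul_add : c * (p + q) = z - 1
  mul_eq : p * q = -z

theorem norm_sq_add_sub_norm_sq (c : ℝ) (p : ℂ) :
    ‖(c : ℂ) + p‖ ^ 2 - ‖1 + c * p‖ ^ 2 = (1 - c ^ 2) * (‖p‖ ^ 2 - 1) := by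
  simp only [Complex.sq_norm, Complex.normSq_apply, Complex.add_re, Complex.add_im, Complex.ofReal_re,
    Complex.ofReal_im, Complex.mul_re, Complex.mul_im, Complex.one_re, Complex.one_im]
  ring

theorem add_ne_zero_of_one_le_norm {c : ℝ} (hc : 0 < c) (hc1 : c < 1) {p : ℂ} (hp : 1 ≤ ‖p‖) :
    (c : ℂ) + p ≠ 0 := by
  intro h
  rw [eq_neg_of_add_eq_zero_right h, norm_neg, Complex.norm_real, norm_eq_abs, abs_of_pos hc] at hp
  linarith

theorem norm_one_add_mul_le {c : ℝ} (hc : 0 < c) (hc1 : c < 1) {p : ℂ} (hp : 1 ≤ ‖p‖) :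
    ‖1 + c * p‖ ≤ ‖(c : ℂ) + p‖ := by
  have h := norm_sq_add_sub_norm_sq c p
  have h0 : 0 ≤ (1 - c ^ 2) * (‖p‖ ^ 2 - 1) :=
    mul_nonneg (by nlinarith) (by nlinarith)
  exact le_of_sq_le_sq (by linarith) (norm_nonneg _)

theorem IsArcPair.of_one_le_norm {c : ℝ} (hc : 0 < c) (hc1 : c < 1) {z p q : ℂ} (hp : 1 ≤ ‖p‖)
    (hadd : c * (p + q) = z - 1) (hmul : p * q = -z) : IsArcPair c z p q := by
  refine ⟨hp, ?_, hadd, hmul⟩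
  have hrel : q * (c + p) = -(1 + c * p) := by linear_combination hadd + hmul
  have hn := congrArg norm hrel
  rw [norm_mul, norm_neg] at hn
  have hpos := norm_pos_iff.mpr (add_ne_zero_of_one_le_norm hc hc1 hp)
  have hle := norm_one_add_mul_le hc hc1 hp
  by_contra! hq
  nlinarith

theorem exists_isArcPair {c : ℝ} (hc : 0 < c) (hc1 : c < 1) (z : ℂ) :
    ∃ p q, IsArcPair c z p q := by
  obtain ⟨p, q, hadd, hmul⟩ := exists_add_mul_eq (Complex.ofReal_ne_zero.mpr hc.ne') z
  rcases le_or_gt 1 ‖p‖ with hp | hp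
  · exact ⟨p, q, .of_one_le_norm hc hc1 hp hadd hmul⟩
  · refine ⟨q, p, .of_one_le_norm hc hc1 ?_ (by rw [add_comm, hadd]) (by rw [mul_comm, hmul])⟩
    have hrel : q * (c + p) = -(1 + c * p) := by linear_combination hadd + hmul
    have hn := congrArg norm hrel
    rw [norm_mul, norm_neg] at hn
    have hsq := norm_sq_add_sub_norm_sq c p
    have hneg : (1 - c ^ 2) * (‖p‖ ^ 2 - 1) < 0 :=
      mul_neg_of_pos_of_neg (by nlinarith) (by nlinarith [norm_nonneg p])
    have hlt : ‖(c : ℂ) + p‖ < ‖1 + c * p‖ := lt_of_pow_lt_pow_left₀ 2 (norm_nonneg _) (by linarith)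
    by_contra! hq
    nlinarith [norm_nonneg ((c : ℂ) + p)]

theorem IsArcPair.right_eq {c : ℝ} (hc : 0 < c) (hc1 : c < 1) {z p q : ℂ}
    (h : IsArcPair c z p q) : q = -(1 + c * p) / (c + p) := by
  rw [eq_div_iff (add_ne_zero_of_one_le_norm hc hc1 h.one_le_norm)]
  linear_combination h.mul_add + h.mul_eq

theorem IsArcPair.eq {c : ℝ} (hc : 0 < c) (hc1 : c < 1) {z p q : ℂ}
    (h : IsArcPair c z p q) : z = p * (1 + c * p) / (c + p) := by
  rw [← neg_eq_iff_eq_neg.mpr h.mul_eq, h.right_eq hc hc1]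
  ring

theorem IsArcPair.norm_arcMap_sub {c : ℝ} (hc : 0 < c) (hc1 : c < 1) {z p q η : ℂ}
    (h : IsArcPair c z p q) (hη : ‖η‖ = 1) :
    ‖arcMap c η - z‖ = c * ‖1 - p * η‖ * ‖1 - q * η‖ / ‖1 - (-c) * η‖ := by
  have h1 := one_add_mul_ne_zero hc hc1 hη.le
  have h0 : η ≠ 0 := by rintro rfl; simp at hη
  have hval : arcMap c η - z = c * (1 - p * η) * (1 - q * η) / (η * (1 + c * η)) := by
    rw [arcMap, div_sub' (mul_ne_zero h0 h1)]
    congr 1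
    linear_combination η * h.mul_add - c * η ^ 2 * h.mul_eq
  rw [hval, norm_div, norm_mul, norm_mul, norm_mul, hη, Complex.norm_real, norm_eq_abs,
    abs_of_pos hc, one_mul, neg_mul, sub_neg_eq_add]

theorem IsArcPair.log_norm_arcMap_sub {c : ℝ} (hc : 0 < c) (hc1 : c < 1) {z p q η : ℂ}
    (h : IsArcPair c z p q) (hη : ‖η‖ = 1) (hp : 1 - p * η ≠ 0) (hq : 1 - q * η ≠ 0) :
    arcMap c η - z ≠ 0 ∧ log ‖arcMap c η - z‖ - log c =
      log ‖1 - p * η‖ + log ‖1 - q * η‖ - log ‖1 - (-c) * η‖ := by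
  have h1 : ‖1 - (-c) * η‖ ≠ 0 := by
    have := one_add_mul_ne_zero hc hc1 hη.le
    rwa [norm_ne_zero_iff, neg_mul, sub_neg_eq_add]
  have hp' := norm_ne_zero_iff.mpr hp
  have hq' := norm_ne_zero_iff.mpr hq
  have hn := h.norm_arcMap_sub hc hc1 hη
  constructor
  · rw [← norm_ne_zero_iff, hn]
    positivity
  · rw [hn, log_div (by positivity) h1, log_mul (by positivity) hq', log_mul hc.ne' hp']
    ring

theorem norm_integral_mul_exp_le_of_two_mul_le {ℓ Λ : ℝ → ℝ} {K : ℝ}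
    (hℓ : IntervalIntegrable ℓ volume 0 (2 * π)) (hΛ : IntervalIntegrable Λ volume 0 (2 * π))
    (hΛ0 : ∀ u, 0 ≤ Λ u) (hle : ∀ᵐ u, 2 * ℓ u ≤ Λ u) (hK : ∫ u in (0:ℝ)..(2 * π), Λ u ≤ K)
    (hpos : 0 ≤ ∫ u in (0:ℝ)..(2 * π), ℓ u) (k : ℕ) :
    ‖∫ u in (0:ℝ)..(2 * π), (ℓ u : ℂ) * Complex.exp (-(k : ℂ) * u * Complex.I)‖ ≤ K := by
  have hnorm : ∀ u : ℝ, ‖(ℓ u : ℂ) * Complex.exp (-(k : ℂ) * u * Complex.I)‖ = |ℓ u| := fun u => by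
    have : -(k : ℂ) * u * Complex.I = ((-(k * u) : ℝ) : ℂ) * Complex.I := by push_cast; ring
    rw [norm_mul, this, Complex.norm_exp_ofReal_mul_I, mul_one, Complex.norm_real, norm_eq_abs]
  refine (intervalIntegral.norm_integral_le_integral_norm two_pi_pos.le).trans ?_
  simp only [hnorm]
  have hmono := intervalIntegral.integral_mono_ae two_pi_pos.le hℓ.abs (hΛ.sub hℓ) (by
    filter_upwards [hle] with u hu
    rw [abs_le]
    constructor <;> linarith [hΛ0 u])
  rw [intervalIntegral.integral_sub hΛ hℓ] at hmono
  linarith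

/-- `∑ᵢ log (|arcMap c η - zᵢ| / c)` at `η = exp (iu)`, written in terms of the arc pairs
`(pᵢ, qᵢ)` of the `zᵢ`. -/
noncomputable def arcLogSum (c : ℝ) {n : ℕ} (p q : Fin n → ℂ) (u : ℝ) : ℝ :=
  ∑ i, (log ‖1 - p i * Complex.exp (u * Complex.I)‖ + log ‖1 - q i * Complex.exp (u * Complex.I)‖ -
    log ‖1 - (-c) * Complex.exp (u * Complex.I)‖)

theorem intervalIntegrable_arcLogSum_summand (c : ℝ) (p q : ℂ) :
    IntervalIntegrable (fun u : ℝ => log ‖1 - p * Complex.exp (u * Complex.I)‖ +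
      log ‖1 - q * Complex.exp (u * Complex.I)‖ - log ‖1 - (-c) * Complex.exp (u * Complex.I)‖)
      volume 0 (2 * π) :=
  ((intervalIntegrable_log_norm_one_sub_mul p).add (intervalIntegrable_log_norm_one_sub_mul q)).sub
    (intervalIntegrable_log_norm_one_sub_mul (-c))

theorem intervalIntegrable_arcLogSum (c : ℝ) {n : ℕ} (p q : Fin n → ℂ) :
    IntervalIntegrable (arcLogSum c p q) volume 0 (2 * π) := by
  have := IntervalIntegrable.sum Finset.univ fun i _ =>
    intervalIntegrable_arcLogSum_summand c (p i) (q i)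
  refine (intervalIntegrable_congr fun u _ => ?_).mp this
  simp [arcLogSum]

theorem integral_arcLogSum {c : ℝ} (hc : 0 < c) (hc1 : c < 1) {n : ℕ} {p q : Fin n → ℂ}
    (hp : ∀ i, 1 ≤ ‖p i‖) (hq : ∀ i, ‖q i‖ ≤ 1) :
    ∫ u in (0:ℝ)..(2 * π), arcLogSum c p q u = 2 * π * ∑ i, log ‖p i‖ := by
  unfold arcLogSum
  rw [intervalIntegral.integral_finsetSum fun i _ =>
    intervalIntegrable_arcLogSum_summand c (p i) (q i), Finset.mul_sum]
  refine Finset.sum_congr rfl fun i _ => ?_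
  have hnc : ‖(-c : ℂ)‖ ≤ 1 := by
    rw [norm_neg, Complex.norm_real, norm_eq_abs, abs_of_pos hc]; exact hc1.le
  rw [intervalIntegral.integral_sub ((intervalIntegrable_log_norm_one_sub_mul _).add
      (intervalIntegrable_log_norm_one_sub_mul _)) (intervalIntegrable_log_norm_one_sub_mul _),
    intervalIntegral.integral_add (intervalIntegrable_log_norm_one_sub_mul _)
      (intervalIntegrable_log_norm_one_sub_mul _), integral_log_norm_one_sub_mul,
    integral_log_norm_one_sub_mul, integral_log_norm_one_sub_mul,
    posLog_eq_log (by rw [abs_of_nonneg (norm_nonneg _)]; exact hp i),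
    (posLog_eq_zero_iff _).mpr (by rw [abs_of_nonneg (norm_nonneg _)]; exact hq i),
    (posLog_eq_zero_iff _).mpr (by rw [abs_of_nonneg (norm_nonneg _)]; exact hnc)]
  ring

theorem integral_arcLogSum_mul_exp {c : ℝ} (hc : 0 < c) (hc1 : c < 1) {n : ℕ} {p q : Fin n → ℂ}
    (hp : ∀ i, 1 ≤ ‖p i‖) (hq : ∀ i, ‖q i‖ ≤ 1) {k : ℕ} (hk : k ≠ 0) :
    ∫ u in (0:ℝ)..(2 * π), (arcLogSum c p q u : ℂ) * Complex.exp (-(k : ℂ) * u * Complex.I) =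
      -π / k * ∑ i, ((star (p i))⁻¹ ^ k + q i ^ k - (-c) ^ k) := by
  have hnc : ‖(-c : ℂ)‖ ≤ 1 := by
    rw [norm_neg, Complex.norm_real, norm_eq_abs, abs_of_pos hc]; exact hc1.le
  have hint : ∀ r : ℂ, IntervalIntegrable (fun u : ℝ =>
      (log ‖1 - r * Complex.exp (u * Complex.I)‖ : ℂ) * Complex.exp (-(k : ℂ) * u * Complex.I))
      volume 0 (2 * π) := fun r =>
    (intervalIntegrable_log_norm_one_sub_mul r).complex_ofReal.mul_continuousOn (by fun_prop)
  simp only [arcLogSum, Complex.ofReal_sum, Finset.sum_mul, Complex.ofReal_sub, Complex.ofReal_add,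
    sub_mul, add_mul]
  rw [intervalIntegral.integral_finsetSum fun i _ =>
    ((hint (p i)).add (hint (q i))).sub (hint (-c)), Finset.mul_sum]
  refine Finset.sum_congr rfl fun i _ => ?_
  rw [intervalIntegral.integral_sub ((hint _).add (hint _)) (hint _),
    intervalIntegral.integral_add (hint _) (hint _),
    integral_log_norm_one_sub_mul_mul_exp_of_one_le (hp i) hk,
    integral_log_norm_one_sub_mul_mul_exp (hq i) hk, integral_log_norm_one_sub_mul_mul_exp hnc hk]
  ring

theorem ae_two_mul_arcLogSum_le {c : ℝ} (hc : 0 < c) (hc1 : c < 1) {n : ℕ} {z p q : Fin n → ℂ}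
    (h : ∀ i, IsArcPair c (z i) (p i) (q i)) :
    ∀ᵐ u : ℝ, 2 * arcLogSum c p q u ≤
      log (1 + ‖∏ i, (arcMap c (Complex.exp (u * Complex.I)) - z i)‖ ^ 2 / c ^ (2 * n)) := by
  have hp := ae_all_iff.mpr fun i => ae_one_sub_mul_exp_ne_zero (p i)
  have hq := ae_all_iff.mpr fun i => ae_one_sub_mul_exp_ne_zero (q i)
  filter_upwards [hp, hq] with u hpu hqu
  have hfac := fun i => (h i).log_norm_arcMap_sub hc hc1 (Complex.norm_exp_ofReal_mul_I u)
    (hpu i) (hqu i)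
  set P := ∏ i, (arcMap c (Complex.exp (u * Complex.I)) - z i) with hP
  have hP0 : ‖P‖ ≠ 0 := norm_ne_zero_iff.mpr (Finset.prod_ne_zero_iff.mpr fun i _ => (hfac i).1)
  have heq : arcLogSum c p q u = log ‖P‖ - n * log c := by
    rw [arcLogSum, Finset.sum_congr rfl fun i _ => (hfac i).2.symm, Finset.sum_sub_distrib, hP,
      norm_prod, log_prod fun i _ => norm_ne_zero_iff.mpr (hfac i).1]
    simp
  have hX : 2 * arcLogSum c p q u = log (‖P‖ ^ 2 / c ^ (2 * n)) := by
    rw [heq, log_div (by positivity) (by positivity), log_pow, log_pow]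
    push_cast
    ring
  rw [hX]
  exact log_le_log (by positivity) (by linarith)

theorem arcPair_sum_bounds {c : ℝ} (hc : 0 < c) (hc1 : c < 1) {n : ℕ} {z p q : Fin n → ℂ}
    (h : ∀ i, IsArcPair c (z i) (p i) (q i)) {K : ℝ}
    (hK : ∫ u in (0:ℝ)..(2 * π),
      log (1 + ‖∏ i, (arcMap c (Complex.exp (u * Complex.I)) - z i)‖ ^ 2 / c ^ (2 * n)) ≤ K) :
    ∑ i, log ‖p i‖ ≤ K / (4 * π) ∧
      ∀ k : ℕ, k ≠ 0 → ‖∑ i, ((star (p i))⁻¹ ^ k + q i ^ k - (-c : ℂ) ^ k)‖ ≤ k * K / π := by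
  have hp := fun i => (h i).one_le_norm
  have hq := fun i => (h i).norm_le_one
  have hℓ := intervalIntegrable_arcLogSum c p q
  have hcont : Continuous fun u : ℝ =>
      log (1 + ‖∏ i, (arcMap c (Complex.exp (u * Complex.I)) - z i)‖ ^ 2 / c ^ (2 * n)) := by
    have := continuous_arcMap_exp hc hc1
    exact Continuous.log (by fun_prop) fun u => by positivity
  have hle := ae_two_mul_arcLogSum_le hc hc1 h
  have hint := integral_arcLogSum hc hc1 hp hq
  constructor
  · have hmono := intervalIntegral.integral_mono_ae two_pi_pos.le (hℓ.const_mul 2)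
      (hcont.intervalIntegrable _ _) hle
    rw [intervalIntegral.integral_const_mul, hint] at hmono
    rw [le_div_iff₀ (by positivity)]
    linarith
  · intro k hk
    have hpos : 0 ≤ ∫ u in (0:ℝ)..(2 * π), arcLogSum c p q u := by
      rw [hint]
      exact mul_nonneg two_pi_pos.le (Finset.sum_nonneg fun i _ => log_nonneg (hp i))
    have hb := norm_integral_mul_exp_le_of_two_mul_le hℓ (hcont.intervalIntegrable _ _)
      (fun u => log_nonneg (le_add_of_nonneg_right (by positivity))) hle hK hpos k
    rw [integral_arcLogSum_mul_exp hc hc1 hp hq hk, norm_mul, norm_div, norm_neg, Complex.norm_real,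
      norm_of_nonneg pi_pos.le, Complex.norm_natCast] at hb
    have hk' : (0:ℝ) < k := by positivity
    rw [le_div_iff₀ pi_pos]
    rw [div_mul_eq_mul_div, div_le_iff₀ hk'] at hb
    linarith

theorem exists_polynomial_re_eq_of_mem_span {T : ℝ} [Fact (0 < T)] {y : C(AddCircle T, ℂ)}
    (hy : y ∈ Submodule.span ℂ (Set.range (@fourier T))) (a : ℂ) :
    ∃ A : Polynomial ℂ, ∀ x, (a * y x).re = (A.eval (AddCircle.toCircle x : ℂ)).re := by
  induction hy using Submodule.span_induction generalizing a with
  | mem y hy =>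
    obtain ⟨m, rfl⟩ := hy
    obtain ⟨k, rfl | rfl⟩ := m.eq_nat_or_neg
    · refine ⟨.C a * .X ^ k, fun x => ?_⟩
      simp [fourier_apply, AddCircle.toCircle_nsmul]
    · refine ⟨.C (star a) * .X ^ k, fun x => ?_⟩
      rw [fourier_neg, ← Complex.conj_re]
      simp [fourier_apply, AddCircle.toCircle_nsmul]
  | zero => exact ⟨0, fun x => by simp⟩
  | add y y' _ _ h h' =>
    obtain ⟨A, hA⟩ := h a
    obtain ⟨A', hA'⟩ := h' a
    exact ⟨A + A', fun x => by
      rw [Polynomial.eval_add, Complex.add_re, ← hA, ← hA', ← Complex.add_re, ← mul_add]; rfl⟩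
  | smul b y _ h =>
    obtain ⟨A, hA⟩ := h (a * b)
    exact ⟨A, fun x => by rw [← hA, mul_assoc]; rfl⟩

theorem exists_polynomial_re_approx {h : ℂ → ℝ} (hh : ContinuousOn h (Metric.sphere 0 1)) {ε : ℝ}
    (hε : 0 < ε) :
    ∃ A : Polynomial ℂ, ∀ ζ : ℂ, ‖ζ‖ = 1 → |h ζ - (A.eval ζ).re| < ε := by
  have : Fact (0 < 2 * π) := ⟨two_pi_pos⟩
  have hcont : Continuous fun x : AddCircle (2 * π) => (h (AddCircle.toCircle x) : ℂ) :=
    Complex.continuous_ofReal.comp (hh.comp_continuous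
      (continuous_subtype_val.comp AddCircle.continuous_toCircle) fun x => x.toCircle.2)
  have hmem : (⟨_, hcont⟩ : C(AddCircle (2 * π), ℂ)) ∈
      (Submodule.span ℂ (Set.range (@fourier (2 * π)))).topologicalClosure := by
    rw [span_fourier_closure_eq_top]; trivial
  obtain ⟨y, hy, hdist⟩ := Metric.mem_closure_iff.mp hmem ε hε
  obtain ⟨A, hA⟩ := exists_polynomial_re_eq_of_mem_span hy 1
  refine ⟨A, fun ζ hζ => ?_⟩
  obtain ⟨x, hx⟩ := (AddCircle.homeomorphCircle two_pi_pos.ne').surjective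
    ⟨ζ, mem_sphere_zero_iff_norm.mpr hζ⟩
  have hxζ : (AddCircle.toCircle x : ℂ) = ζ := by
    rw [AddCircle.homeomorphCircle_apply] at hx
    exact congrArg Subtype.val hx
  have hd := (ContinuousMap.dist_apply_le_dist x).trans_lt hdist
  rw [← hxζ, ← hA, one_mul]
  rw [dist_eq_norm] at hd
  refine lt_of_le_of_lt ?_ hd
  refine le_trans (le_of_eq ?_) (Complex.abs_re_le_norm _)
  simp

theorem exists_le_add_mul_log_norm {D : ℂ → ℝ} {ε M : ℝ} (hε : 0 ≤ ε)
    (hD : ContinuousOn D {p | 1 ≤ ‖p‖}) (hM : ∀ p, 1 ≤ ‖p‖ → |D p| ≤ M)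
    (hcirc : ∀ p, ‖p‖ = 1 → |D p| < ε) :
    ∃ C, 0 ≤ C ∧ ∀ p, 1 ≤ ‖p‖ → |D p| ≤ ε + C * log ‖p‖ := by
  have hM0 : 0 ≤ M := (abs_nonneg _).trans (hM 1 (by simp))
  have hann : IsCompact (Metric.closedBall (0:ℂ) 2 ∩ {p | 1 ≤ ‖p‖}) :=
    (isCompact_closedBall 0 2).inter_right (isClosed_le continuous_const continuous_norm)
  have hS : IsCompact ((Metric.closedBall (0:ℂ) 2 ∩ {p | 1 ≤ ‖p‖}) ∩
      (fun p => |D p|) ⁻¹' Set.Ici ε) :=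
    hann.of_isClosed_subset (((hD.mono Set.inter_subset_right).abs).preimage_isClosed_of_isClosed
      hann.isClosed isClosed_Ici) Set.inter_subset_left
  obtain ⟨δ, hδ, hδS⟩ : ∃ δ > 0, ∀ p, 1 ≤ ‖p‖ → ‖p‖ ≤ 2 → ε ≤ |D p| → δ ≤ log ‖p‖ := by
    rcases Set.eq_empty_or_nonempty ((Metric.closedBall (0:ℂ) 2 ∩ {p | 1 ≤ ‖p‖}) ∩
      (fun p => |D p|) ⁻¹' Set.Ici ε) with hE | hE
    · refine ⟨1, one_pos, fun p h1 h2 h3 => ?_⟩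
      have : p ∈ (∅ : Set ℂ) := hE ▸ ⟨⟨by simpa using h2, h1⟩, h3⟩
      exact this.elim
    · obtain ⟨p₀, hp₀, hmin⟩ := hS.exists_isMinOn hE continuous_norm.continuousOn
      have hne : ‖p₀‖ ≠ 1 := fun h => (hcirc p₀ h).not_ge hp₀.2
      have hgt : 1 < ‖p₀‖ := lt_of_le_of_ne hp₀.1.2 hne.symm
      refine ⟨log ‖p₀‖, log_pos hgt, fun p h1 h2 h3 => log_le_log (by linarith) ?_⟩
      exact hmin ⟨⟨by simpa using h2, h1⟩, h3⟩
  have hlog2 : 0 < log 2 := log_pos one_lt_two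
  have hmin : 0 < min δ (log 2) := lt_min hδ hlog2
  refine ⟨M / min δ (log 2), by positivity, fun p hp => ?_⟩
  have hlog := log_nonneg hp
  rcases lt_or_ge |D p| ε with hlt | hge
  · exact hlt.le.trans (le_add_of_nonneg_right (by positivity))
  · have hle : min δ (log 2) ≤ log ‖p‖ := by
      rcases le_total ‖p‖ 2 with h2 | h2
      · exact (min_le_left _ _).trans (hδS p hp h2 hge)
      · exact (min_le_right _ _).trans (log_le_log two_pos h2)
    calc |D p| ≤ M := hM p hp
      _ = M / min δ (log 2) * min δ (log 2) := by field_simp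
      _ ≤ M / min δ (log 2) * log ‖p‖ := mul_le_mul_of_nonneg_left hle (by positivity)
      _ ≤ _ := le_add_of_nonneg_left hε

theorem exists_norm_sum_eval_sub_le (c : ℝ) (A : Polynomial ℂ) :
    ∃ C : ℝ, ∀ (n : ℕ) (x y : Fin n → ℂ) (K : ℝ),
      (∀ k : ℕ, k ≠ 0 → ‖∑ i, (x i ^ k + y i ^ k - (-c : ℂ) ^ k)‖ ≤ k * K / π) →
      ‖∑ i, (A.eval (x i) + A.eval (y i) - (A.eval 0 + A.eval (-c : ℂ)))‖ ≤ C * K := by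
  induction A using Polynomial.induction_on' with
  | add A B hA hB =>
    obtain ⟨C, hC⟩ := hA
    obtain ⟨C', hC'⟩ := hB
    refine ⟨C + C', fun n x y K hK => ?_⟩
    have h := (norm_add_le _ _).trans (add_le_add (hC n x y K hK) (hC' n x y K hK))
    rw [← Finset.sum_add_distrib, ← add_mul] at h
    refine le_of_eq_of_le (congrArg norm (Finset.sum_congr rfl fun i _ => ?_)) h
    simp only [Polynomial.eval_add]
    ring
  | monomial k a =>
    rcases eq_or_ne k 0 with rfl | hk
    · exact ⟨0, fun n x y K _ => by simp⟩
    · refine ⟨‖a‖ * (k / π), fun n x y K hK => ?_⟩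
      have h := mul_le_mul_of_nonneg_left (hK k hk) (norm_nonneg a)
      rw [← norm_mul, Finset.mul_sum] at h
      refine (le_of_eq_of_le (congrArg norm (Finset.sum_congr rfl fun i _ => ?_)) h).trans_eq ?_
      · simp only [Polynomial.eval_monomial, zero_pow hk]
        ring
      · ring

theorem isArcPair_of_one_le_norm {c : ℝ} (hc : 0 < c) (hc1 : c < 1) {p : ℂ} (hp : 1 ≤ ‖p‖) :
    IsArcPair c (p * (1 + c * p) / (c + p)) p (-(1 + c * p) / (c + p)) := by
  have h0 := add_ne_zero_of_one_le_norm hc hc1 hp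
  refine .of_one_le_norm hc hc1 hp ?_ ?_
  · field_simp
    ring
  · ring

theorem IsArcPair.norm_right_eq_one {c : ℝ} (hc : 0 < c) (hc1 : c < 1) {z p q : ℂ}
    (h : IsArcPair c z p q) (hp : ‖p‖ = 1) : ‖q‖ = 1 := by
  have hsq := norm_sq_add_sub_norm_sq c p
  rw [hp, one_pow, sub_self, mul_zero, sub_eq_zero] at hsq
  have hnorm := (sq_eq_sq₀ (norm_nonneg _) (norm_nonneg _)).mp hsq
  have h0 := norm_ne_zero_iff.mpr (add_ne_zero_of_one_le_norm hc hc1 h.one_le_norm)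
  rw [h.right_eq hc hc1, norm_div, norm_neg, ← hnorm, div_self h0]

theorem IsArcPair.symm {c : ℝ} {z p q : ℂ} (h : IsArcPair c z p q) (hp : ‖p‖ = 1) (hq : ‖q‖ = 1) :
    IsArcPair c z q p :=
  ⟨hq.ge, hp.le, by rw [add_comm, h.mul_add], by rw [mul_comm, h.mul_eq]⟩

theorem IsArcPair.arcMap_inv {c : ℝ} (hc : 0 < c) (hc1 : c < 1) {z p q : ℂ}
    (h : IsArcPair c z p q) : arcMap c p⁻¹ = z := by
  have hp0 : p ≠ 0 := by
    rintro rfl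
    have := h.one_le_norm
    norm_num at this
  have h0 := add_ne_zero_of_one_le_norm hc hc1 h.one_le_norm
  have h0' : p + c ≠ 0 := by rwa [add_comm]
  rw [h.eq hc hc1, arcMap]
  field_simp
  ring

theorem continuousOn_arcMap_inv_sphere {c : ℝ} (hc : 0 < c) (hc1 : c < 1) :
    ContinuousOn (fun ζ => arcMap c ζ⁻¹) (Metric.sphere 0 1) := by
  have hne : ∀ ζ ∈ Metric.sphere (0:ℂ) 1, ζ ≠ 0 := by
    rintro _ h rfl
    simp at h
  have hinv : ContinuousOn (fun ζ : ℂ => ζ⁻¹) (Metric.sphere 0 1) := continuousOn_id.inv₀ hne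
  refine ContinuousOn.div (by fun_prop) (by fun_prop) fun ζ hζ =>
    mul_ne_zero (inv_ne_zero (hne ζ hζ)) (one_add_mul_ne_zero hc hc1 ?_)
  rw [norm_inv, mem_sphere_zero_iff_norm.mp hζ, inv_one]

theorem exists_abs_sub_re_eval_le {c : ℝ} (hc : 0 < c) (hc1 : c < 1)
    (g : BoundedContinuousFunction ℂ ℝ) {ε : ℝ} (hε : 0 < ε) {A : Polynomial ℂ}
    (hA : ∀ ζ : ℂ, ‖ζ‖ = 1 → |g (arcMap c ζ⁻¹) - (A.eval ζ).re| < ε) :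
    ∃ C, 0 ≤ C ∧ ∀ z p q, IsArcPair c z p q →
      |g z - ((A.eval (star p)⁻¹).re + (A.eval q).re) / 2| ≤ ε + C * log ‖p‖ := by
  set D : ℂ → ℝ := fun p => g (p * (1 + c * p) / (c + p)) -
    ((A.eval (star p)⁻¹).re + (A.eval (-(1 + c * p) / (c + p))).re) / 2 with hD
  obtain ⟨M, hM⟩ := (isCompact_closedBall (0:ℂ) 1).exists_bound_of_continuousOn
    A.continuous.continuousOn
  have hstar : ∀ p : ℂ, 1 ≤ ‖p‖ → ‖(star p)⁻¹‖ ≤ 1 := fun p hp => by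
    rw [norm_inv, norm_star]; exact inv_le_one_of_one_le₀ hp
  have hre : ∀ x : ℂ, ‖x‖ ≤ 1 → |(A.eval x).re| ≤ M := fun x hx =>
    (Complex.abs_re_le_norm _).trans (hM x (mem_closedBall_zero_iff.mpr hx))
  have hcont : ContinuousOn D {p | 1 ≤ ‖p‖} := by
    have hden : ∀ p ∈ {p : ℂ | 1 ≤ ‖p‖}, (c : ℂ) + p ≠ 0 := fun p hp =>
      add_ne_zero_of_one_le_norm hc hc1 hp
    have h1 : ContinuousOn (fun p : ℂ => p * (1 + c * p) / (c + p)) {p | 1 ≤ ‖p‖} :=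
      ContinuousOn.div (by fun_prop) (by fun_prop) hden
    have h2 : ContinuousOn (fun p : ℂ => -(1 + c * p) / (c + p)) {p | 1 ≤ ‖p‖} :=
      ContinuousOn.div (by fun_prop) (by fun_prop) hden
    have h3 : ContinuousOn (fun p : ℂ => (star p)⁻¹) {p | 1 ≤ ‖p‖} :=
      continuous_star.continuousOn.inv₀ fun p hp => star_ne_zero.mpr (by
        rintro rfl
        simp only [Set.mem_ofPred_eq, norm_zero] at hp
        linarith)
    have hAre : Continuous fun x => (A.eval x).re := Complex.continuous_re.comp A.continuous
    exact (g.continuous.comp_continuousOn h1).sub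
      (((hAre.comp_continuousOn h3).add (hAre.comp_continuousOn h2)).div_const 2)
  have hbound : ∀ p, 1 ≤ ‖p‖ → |D p| ≤ ‖g‖ + M := fun p hp => by
    have h1 := abs_le.mp (g.norm_coe_le_norm (p * (1 + c * p) / (c + p)))
    have h2 := abs_le.mp (hre _ (hstar p hp))
    have h3 := abs_le.mp (hre _ (isArcPair_of_one_le_norm hc hc1 hp).norm_le_one)
    rw [abs_le]
    constructor <;> simp only [hD] <;> linarith
  have hcirc : ∀ p, ‖p‖ = 1 → |D p| < ε := fun p hp => by
    have hpair := isArcPair_of_one_le_norm hc hc1 hp.ge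
    have hq := hpair.norm_right_eq_one hc hc1 hp
    have h1 := abs_lt.mp (hA p hp)
    have h2 := abs_lt.mp (hA _ hq)
    rw [hpair.arcMap_inv hc hc1] at h1
    rw [(hpair.symm hp hq).arcMap_inv hc hc1] at h2
    have hpp : (star p)⁻¹ = p := by
      rw [inv_eq_iff_eq_inv, Complex.inv_eq_conj hp]; rfl
    rw [abs_lt]
    constructor <;> simp only [hD, hpp] <;> linarith
  obtain ⟨C, hC0, hC⟩ := exists_le_add_mul_log_norm hε.le hcont hbound hcirc
  refine ⟨C, hC0, fun z p q h => ?_⟩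
  have := hC p h.one_le_norm
  simp only [hD] at this
  rwa [← h.eq hc hc1, ← h.right_eq hc hc1] at this

theorem abs_integral_sub_re_le_of_diffContOnCl {f : ℂ → ℂ} (hf : DiffContOnCl ℂ f (Metric.ball 0 1))
    {k : ℝ → ℝ} (hk : Continuous k) {ε : ℝ}
    (hkf : ∀ u : ℝ, |k u - (f (Complex.exp (u * Complex.I))).re| ≤ ε) :
    |(1 / (2 * π)) * (∫ u in (0:ℝ)..(2 * π), k u) - (f 0).re| ≤ ε := by
  have hcircle : Continuous fun u : ℝ => f (Complex.exp (u * Complex.I)) :=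
    hf.continuousOn_ball.comp_continuous (by fun_prop) fun u => by simp
  have hmean := DiffContOnCl.circleAverage (c := 0) (R := 1) (f := f) (by rwa [abs_one])
  simp only [circleAverage, circleMap_zero, Complex.ofReal_one, one_mul] at hmean
  have hre : (f 0).re = (1 / (2 * π)) * ∫ u in (0:ℝ)..(2 * π), (f (Complex.exp (u * Complex.I))).re := by
    rw [← hmean, Complex.smul_re, smul_eq_mul, one_div]
    congr 1
    exact (intervalIntegral.intervalIntegral_re (hcircle.intervalIntegrable _ _)).symm
  have hcircle_re : Continuous fun u : ℝ => (f (Complex.exp (u * Complex.I))).re :=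
    Complex.continuous_re.comp hcircle
  have hint := intervalIntegral.norm_integral_le_of_norm_le_const (a := 0) (b := 2 * π)
    (f := fun u => k u - (f (Complex.exp (u * Complex.I))).re) fun u _ => hkf u
  rw [intervalIntegral.integral_sub (hk.intervalIntegrable _ _)
    (hcircle_re.intervalIntegrable _ _), sub_zero,
    abs_of_pos two_pi_pos, norm_eq_abs] at hint
  rw [hre, ← mul_sub, abs_mul, abs_of_pos (by positivity), one_div_mul_eq_div,
    div_le_iff₀ two_pi_pos]
  exact hint

theorem integral_comp_exp_inv (k : ℂ → ℝ) :
    ∫ u in (0:ℝ)..(2 * π), k (Complex.exp (u * Complex.I))⁻¹ =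
      ∫ u in (0:ℝ)..(2 * π), k (Complex.exp (u * Complex.I)) := by
  have h := intervalIntegral.integral_comp_sub_left (a := 0) (b := 2 * π)
    (fun u : ℝ => k (Complex.exp (u * Complex.I))) (2 * π)
  rw [sub_self, sub_zero] at h
  rw [← h]
  refine intervalIntegral.integral_congr fun u _ => ?_
  have : Complex.exp (((2 * π - u : ℝ) : ℂ) * Complex.I) = (Complex.exp (u * Complex.I))⁻¹ := by
    rw [← Complex.exp_neg, ← Complex.exp_periodic (-(u * Complex.I))]
    congr 1
    push_cast
    ring
  simp only [this]

theorem abs_re_eval_sub_integral_arcMap_le {c : ℝ} (hc : 0 < c) (hc1 : c < 1)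
    (g : BoundedContinuousFunction ℂ ℝ) {ε : ℝ} {A : Polynomial ℂ}
    (hA : ∀ ζ : ℂ, ‖ζ‖ = 1 → |g (arcMap c ζ⁻¹) - (A.eval ζ).re| < ε) :
    |(1 / (2 * π)) * (∫ u in (0:ℝ)..(2 * π), g (arcMap c (Complex.exp (u * Complex.I)))) -
      ((A.eval 0).re + (A.eval (-c : ℂ)).re) / 2| ≤ ε := by
  have hcont := continuous_arcMap_exp hc hc1
  have h1 := abs_integral_sub_re_le_of_diffContOnCl (f := fun ζ => A.eval ζ)
    A.differentiable.diffContOnCl (k := fun u : ℝ => g (arcMap c (Complex.exp (u * Complex.I))⁻¹))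
    (by
      refine g.continuous.comp ?_
      exact (continuousOn_arcMap_inv_sphere hc hc1).comp_continuous
        (f := fun u : ℝ => Complex.exp (u * Complex.I)) (by fun_prop) fun u => by simp)
    fun u => (hA _ (Complex.norm_exp_ofReal_mul_I u)).le
  rw [integral_comp_exp_inv fun η => g (arcMap c η)] at h1
  have hmob : DiffContOnCl ℂ (fun η : ℂ => A.eval (-(η + c) / (1 + c * η))) (Metric.ball 0 1) := by
    refine DifferentiableOn.diffContOnCl ?_
    rw [closure_ball _ one_ne_zero]
    refine A.differentiable.comp_differentiableOn (DifferentiableOn.div (by fun_prop) (by fun_prop)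
      fun η hη => one_add_mul_ne_zero hc hc1 (mem_closedBall_zero_iff.mp hη))
  have h2 := abs_integral_sub_re_le_of_diffContOnCl hmob (g.continuous.comp hcont) (ε := ε)
    fun u => by
      have hη := Complex.norm_exp_ofReal_mul_I u
      have hη0 := Complex.exp_ne_zero (u * Complex.I)
      set η := Complex.exp (u * Complex.I)
      have hη1 : ‖η⁻¹‖ = 1 := by rw [norm_inv, hη, inv_one]
      have hpair := isArcPair_of_one_le_norm hc hc1 hη1.ge
      have hq := hpair.norm_right_eq_one hc hc1 hη1
      have hbd := hA _ hq
      rw [(hpair.symm hη1 hq).arcMap_inv hc hc1, ← hpair.arcMap_inv hc hc1, inv_inv] at hbd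
      have hqη : -(1 + c * η⁻¹) / (c + η⁻¹) = -(η + c) / (1 + c * η) := by
        rw [div_eq_div_iff (add_ne_zero_of_one_le_norm hc hc1 hη1.ge)
          (one_add_mul_ne_zero hc hc1 hη.le)]
        field_simp
        ring
      rw [hqη] at hbd
      exact hbd.le
  simp only [zero_add, mul_zero, add_zero, div_one, Function.comp_apply] at h1 h2
  rw [abs_le] at h1 h2 ⊢
  constructor <;> linarith [h1.1, h1.2, h2.1, h2.2]

theorem exists_fin_roots {φ : Polynomial ℂ} (hφ : φ.Monic) {n : ℕ} (hn : φ.natDegree = n) :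
    ∃ z : Fin n → ℂ, (∀ x, φ.eval x = ∏ i, (x - z i)) ∧
      ∀ g : ℂ → ℝ, (φ.roots.map g).sum = ∑ i, g (z i) := by
  have hcard : φ.roots.toList.length = n := by
    rw [Multiset.length_toList, IsAlgClosed.card_roots_eq_natDegree, hn]
  obtain ⟨z, hz⟩ : ∃ z : Fin n → ℂ, φ.roots = Finset.univ.val.map z := by
    subst hcard
    refine ⟨φ.roots.toList.get, ?_⟩
    rw [Fin.univ_val_map, List.ofFn_get, Multiset.coe_toList]
  refine ⟨z, fun x => ?_, fun g => ?_⟩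
  · rw [(IsAlgClosed.splits φ).eval_eq_prod_roots_of_monic hφ, hz, Multiset.map_map]
    rfl
  · rw [hz, Multiset.map_map]
    rfl

theorem integral_log_one_add_norm_sq_le {L : ℝ} (hL : L ∈ Set.Ioo 0 π) {s : ℝ} (hs : 0 ≤ s)
    {n : ℕ} (hn : n ≠ 0) (hsmall : s ≤ tan (L / 4) ^ (2 * n)) {φ : Polynomial ℂ}
    (hφ : φ.Monic) (hφn : φ.natDegree = n)
    (horth : ∀ k < n, (1 / (2 * (π:ℂ))) * ∫ θ in (0:ℝ)..(2 * π),
        φ.eval (Complex.exp (θ * Complex.I)) * Complex.exp (-(k:ℂ) * θ * Complex.I) *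
          (weight L s θ : ℂ) = 0) :
    ∫ u in (0:ℝ)..(2 * π), log (1 + ‖φ.eval (arcMap (sin (L / 2)) (Complex.exp (u * Complex.I)))‖ ^ 2
        / sin (L / 2) ^ (2 * n)) ≤
      (sin (L / 2))⁻¹ * (8 * π) - 2 * ∫ w in (-(π / 2))..(π / 2), log (cos w) := by
  obtain ⟨hc, hc1⟩ := sin_half_mem_Ioo hL
  have h1 := integral_log_one_add_arcMap_le hL
    (X := fun z => ‖φ.eval z‖ ^ 2 / sin (L / 2) ^ (2 * n)) (by fun_prop) fun z => by positivity
  have h2 := integral_norm_sq_le_of_orthogonal hL hs hn hsmall hφ hφn horth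
  rw [← div_le_iff₀ (by positivity), ← intervalIntegral.integral_div] at h2
  refine h1.trans ?_
  gcongr

theorem abs_sum_sub_le_of_isArcPair {c : ℝ} {g : ℂ → ℝ} {A : Polynomial ℂ} {ε C C' K : ℝ}
    (hC0 : 0 ≤ C) {n : ℕ} {z p q : Fin n → ℂ} (h : ∀ i, IsArcPair c (z i) (p i) (q i))
    (hC : ∀ z p q, IsArcPair c z p q →
      |g z - ((A.eval (star p)⁻¹).re + (A.eval q).re) / 2| ≤ ε + C * log ‖p‖)
    (hC' : ‖∑ i, (A.eval (star (p i))⁻¹ + A.eval (q i) - (A.eval 0 + A.eval (-c : ℂ)))‖ ≤ C' * K)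
    (hlog : ∑ i, log ‖p i‖ ≤ K / (4 * π)) :
    |∑ i, g (z i) - n * (((A.eval 0).re + (A.eval (-c : ℂ)).re) / 2)| ≤
      n * ε + (C / (4 * π) + C' / 2) * K := by
  have h1 : |∑ i, (g (z i) - ((A.eval (star (p i))⁻¹).re + (A.eval (q i)).re) / 2)| ≤
      n * ε + C * (K / (4 * π)) := by
    refine (Finset.abs_sum_le_sum_abs _ _).trans ((Finset.sum_le_sum fun i _ => hC _ _ _ (h i)).trans ?_)
    rw [Finset.sum_add_distrib, ← Finset.mul_sum]
    simp only [Finset.sum_const, Finset.card_univ, Fintype.card_fin, nsmul_eq_mul]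
    gcongr
  have h2 := (Complex.abs_re_le_norm _).trans hC'
  simp only [Complex.re_sum, Complex.sub_re, Complex.add_re] at h2
  have heq : ∑ i, g (z i) - n * (((A.eval 0).re + (A.eval (-c : ℂ)).re) / 2) =
      ∑ i, (g (z i) - ((A.eval (star (p i))⁻¹).re + (A.eval (q i)).re) / 2) +
      (∑ i, ((A.eval (star (p i))⁻¹).re + (A.eval (q i)).re -
        ((A.eval 0).re + (A.eval (-c : ℂ)).re))) / 2 := by
    simp only [Finset.sum_sub_distrib, ← Finset.sum_div, Finset.sum_const, Finset.card_univ,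
      Fintype.card_fin, nsmul_eq_mul]
    ring
  rw [heq]
  refine (abs_add_le _ _).trans ?_
  rw [abs_div, abs_two]
  calc _ ≤ n * ε + C * (K / (4 * π)) + C' * K / 2 := by gcongr
    _ = _ := by ring

theorem stmt18 (L : ℝ) (hL : L ∈ Set.Ioo 0 π)
    (s : ℕ → ℝ) (hs : ∀ n, s n ∈ Set.Ioo (0:ℝ) 1)
    (hsmall : ∀ n, s n ≤ Real.tan (L / 4) ^ (2 * n))
    (φ : ℕ → Polynomial ℂ)
    (hmonic : ∀ n, (φ n).Monic) (hdeg : ∀ n, (φ n).natDegree = n)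
    (horth : ∀ n : ℕ, ∀ k < n, (1 / (2 * (π:ℂ))) * ∫ θ in (0:ℝ)..(2 * π),
        (φ n).eval (Complex.exp (θ * Complex.I)) * Complex.exp (-(k:ℂ) * θ * Complex.I) *
          (weight L (s n) θ : ℂ) = 0) :
    ∀ g : BoundedContinuousFunction ℂ ℝ,
      Tendsto (fun n : ℕ => ((φ n).roots.map (fun z => g z)).sum / (n : ℝ)) atTop
        (nhds (∫ θ in (-L)..L, g (Complex.exp (θ * Complex.I)) *
          ((1 / (2 * π)) * Real.sqrt ((Real.cos θ + 1) / (Real.cos θ - Real.cos L))))) := by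
  intro g
  obtain ⟨hc, hc1⟩ := sin_half_mem_Ioo hL
  rw [integral_arc_density hL g.continuous, Metric.tendsto_atTop]
  intro ε hε
  obtain ⟨A, hA⟩ := exists_polynomial_re_approx (h := fun ζ => g (arcMap (sin (L / 2)) ζ⁻¹))
    (g.continuous.comp_continuousOn (continuousOn_arcMap_inv_sphere hc hc1))
    (show 0 < ε / 3 by positivity)
  obtain ⟨C, hC0, hC⟩ := exists_abs_sub_re_eval_le hc hc1 g (by positivity) hA
  obtain ⟨C', hC'⟩ := exists_norm_sum_eval_sub_le (sin (L / 2)) A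
  have hint := abs_re_eval_sub_integral_arcMap_le hc hc1 g hA
  set K := (sin (L / 2))⁻¹ * (8 * π) - 2 * ∫ w in (-(π / 2))..(π / 2), log (cos w) with hK
  obtain ⟨N, hN⟩ := exists_nat_gt ((C / (4 * π) + C' / 2) * K / (ε / 3))
  refine ⟨max N 1, fun n hn => ?_⟩
  have hn0 : n ≠ 0 := (lt_of_lt_of_le one_pos ((le_max_right _ _).trans hn)).ne'
  have hnpos : (0:ℝ) < n := by positivity
  obtain ⟨z, hz, hsum⟩ := exists_fin_roots (hmonic n) (hdeg n)
  choose p q hpq using fun i => exists_isArcPair hc hc1 (z i)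
  have hbd := integral_log_one_add_norm_sq_le hL (hs n).1.le hn0 (hsmall n) (hmonic n) (hdeg n)
    (horth n)
  simp only [hz] at hbd
  obtain ⟨hlog, hpow⟩ := arcPair_sum_bounds hc hc1 hpq hbd
  have hmain := abs_sum_sub_le_of_isArcPair hC0 hpq hC (hC' n _ _ K hpow) hlog
  have hNn : (C / (4 * π) + C' / 2) * K < n * (ε / 3) := by
    rw [← div_lt_iff₀ (by positivity)]
    exact hN.trans_le (Nat.cast_le.mpr ((le_max_left _ _).trans hn))
  rw [hsum, dist_eq_norm, norm_eq_abs]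
  set m := ((A.eval 0).re + (A.eval (-(sin (L / 2) : ℝ) : ℂ)).re) / 2
  have hdiv : |(∑ i, g (z i)) / n - m| < 2 * (ε / 3) := by
    have : (∑ i, g (z i)) / n - m = (∑ i, g (z i) - n * m) / n := by field_simp
    rw [this, abs_div, abs_of_pos hnpos, div_lt_iff₀ hnpos]
    linarith
  rw [abs_lt] at hdiv ⊢
  rw [abs_le] at hint
  constructor <;> linarith [hint.1, hint.2, hdiv.1, hdiv.2]
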